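/- arXiv:1803.01031 — 3 statements merged into one kernel-verified Lean document; each statement's English description precedes it below -/
import Mathlib

section
/- Let PA(q) = ∑_{n≥1} pa(n) q^n. Then as ε → 0^+, PA(e^{−ε}) is asymptotically equal to √(ε/π)·e^{A/ε}, where A = π²/12 + 2(log((1+√5)/2))²; that is, the ratio of the two sides tends to 1 as ε → 0^+. -/
open Filter Topology

/-- A partition is (unlimited) parity alternating if any two consecutive distinct part
sizes have opposite parity. -/
def ParityAlternating {n : ℕ} (p : n.Partition) : Prop :=
  ∀ a ∈ p.parts, ∀ b ∈ p.parts, a < b →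
    (∀ c ∈ p.parts, ¬(a < c ∧ c < b)) → (Odd a ↔ Even b)

/-- The number of unlimited parity alternating partitions of `n`. -/
noncomputable def pa (n : ℕ) : ℕ := Nat.card {p : n.Partition // ParityAlternating p}


lemma eta_norm (y : ℝ) (hy : 0 < y) :
    ‖ModularForm.eta (Complex.I * y)‖ =
      Real.exp (-(2 * Real.pi * y) / 24) * ∏' n : ℕ, (1 - Real.exp (-(2 * Real.pi * y)) ^ (n + 1)) := by
  have hq1 : Real.exp (-(2 * Real.pi * y)) < 1 := by
    rw [Real.exp_lt_one_iff]
    have := Real.pi_pos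
    simp; positivity
  have h1 : ∀ n : ℕ, (1 - ModularForm.eta_q n (Complex.I * y)) =
      ((1 - Real.exp (-(2 * Real.pi * y)) ^ (n + 1) : ℝ) : ℂ) := by
    intro n
    rw [ModularForm.eta_q_eq_pow]
    push_cast
    congr 3
    ring_nf
    simp
  unfold ModularForm.eta
  simp_rw [h1]
  have hmul : Multipliable fun n : ℕ => (1 - Real.exp (-(2 * Real.pi * y)) ^ (n + 1)) := by
    simp_rw [sub_eq_add_neg]
    apply Real.multipliable_one_add_of_summable
    exact ((summable_nat_add_iff 1).2 (summable_geometric_of_lt_one (Real.exp_pos _).le hq1)).neg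
  have hmap := hmul.map_tprod Complex.ofRealHom Complex.continuous_ofReal
  simp only [Complex.ofRealHom_eq_coe] at hmap
  rw [← hmap, norm_mul]
  congr 1
  · rw [Function.Periodic.qParam, Complex.norm_exp]
    congr 1
    simp
  · rw [Complex.norm_real, Real.norm_eq_abs, abs_of_nonneg]
    apply tprod_nonneg
    intro n
    have := pow_le_one₀ (n := n + 1) (Real.exp_pos (-(2 * Real.pi * y))).le hq1.le
    linarith

lemma eta_trans (y : ℝ) (hy : 0 < y) :
    ‖ModularForm.eta (Complex.I * (y⁻¹ : ℝ))‖ = Real.sqrt y * ‖ModularForm.eta (Complex.I * y)‖ := by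
  have h := ModularForm.eta_comp_eq_csqrt_I_inv (x := Complex.I * y)
    (by simpa [UpperHalfPlane.upperHalfPlaneSet] using hy)
  have e : -1 / (Complex.I * y) = Complex.I * (y⁻¹ : ℝ) := by
    have : (y : ℂ) ≠ 0 := by exact_mod_cast hy.ne'
    push_cast
    field_simp
    simp
  simp only [Function.comp, e, Pi.smul_apply, Pi.mul_apply, smul_eq_mul] at h
  rw [h]
  have hs : ∀ z : ℂ, ‖Complex.sqrt z‖ = Real.sqrt ‖z‖ := by
    intro z
    have hh : Complex.sqrt z ^ 2 = z := by
      unfold Complex.sqrt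
      exact_mod_cast Complex.cpow_nat_inv_pow z two_ne_zero
    have : ‖Complex.sqrt z‖ ^ 2 = ‖z‖ := by rw [← norm_pow, hh]
    rw [← this, Real.sqrt_sq (norm_nonneg _)]
  simp [hs, abs_of_pos hy]

lemma euler_tendsto_one : Tendsto (fun q : ℝ => ∏' n : ℕ, (1 - q ^ (n + 1))) (𝓝 0) (𝓝 1) := by
  have := tendsto_tprod_one_add_of_dominated_convergence (𝓕 := 𝓝 0) (g := 0)
      (f := fun (q : ℝ) (n : ℕ) ↦ -q ^ (n + 1)) (bound := fun n ↦ (1 / 2 : ℝ) ^ (n + 1))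
  simp only [Pi.zero_apply, norm_neg, norm_pow, add_zero, tprod_one] at this
  simp_rw [sub_eq_add_neg]
  refine this
      (by simpa only [pow_succ'] using (summable_geometric_of_abs_lt_one (by norm_num)).mul_left _)
      (fun k ↦ by simpa using ((continuous_pow (M := ℝ) (k + 1)).tendsto 0).neg) ?_
  filter_upwards [Metric.ball_mem_nhds (0 : ℝ) (by norm_num : (0 : ℝ) < 1 / 2)] with q hq k
  exact pow_le_pow_left₀ (norm_nonneg _) (mem_ball_zero_iff.mp hq).le _

lemma euler_prod_eq (ε : ℝ) (hε : 0 < ε) :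
    Real.exp (-(2 * (Real.pi ^ 2 / ε)) / 24) * ∏' n : ℕ, (1 - Real.exp (-(2 * (Real.pi ^ 2 / ε))) ^ (n + 1)) =
    Real.sqrt (ε / Real.pi) * (Real.exp (-(2 * ε) / 24) * ∏' n : ℕ, (1 - Real.exp (-(2 * ε)) ^ (n + 1))) := by
  have hp := Real.pi_pos
  have h := eta_trans (ε / Real.pi) (by positivity)
  rw [eta_norm _ (by positivity), eta_norm _ (by positivity)] at h
  have e1 : 2 * Real.pi * (ε / Real.pi)⁻¹ = 2 * (Real.pi ^ 2 / ε) := by field_simp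
  have e2 : 2 * Real.pi * (ε / Real.pi) = 2 * ε := by field_simp
  rw [e1, e2] at h
  exact h

lemma euler_asymp : Tendsto (fun ε : ℝ => (∏' n : ℕ, (1 - Real.exp (-(2 * ε)) ^ (n + 1)))⁻¹ /
    (Real.sqrt (ε / Real.pi) * Real.exp (Real.pi ^ 2 / 12 / ε))) (𝓝[>] 0) (𝓝 1) := by
  have hp := Real.pi_pos
  have h1 : Tendsto (fun ε : ℝ => Real.exp (-(2 * (Real.pi ^ 2 / ε)))) (𝓝[>] 0) (𝓝 0) := by
    have h0 : Tendsto (fun ε : ℝ => 2 * (Real.pi ^ 2 / ε)) (𝓝[>] 0) atTop := by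
      have h00 : Tendsto (fun ε : ℝ => Real.pi ^ 2 * ε⁻¹) (𝓝[>] 0) atTop :=
        Tendsto.const_mul_atTop (by positivity) tendsto_inv_nhdsGT_zero
      exact Tendsto.const_mul_atTop (by norm_num) h00
    exact Real.tendsto_exp_neg_atTop_nhds_zero.comp h0
  have h2 := (euler_tendsto_one.comp h1).inv₀ one_ne_zero
  have h3 : Tendsto (fun ε : ℝ => Real.exp (-(2 * ε) / 24)) (𝓝[>] 0) (𝓝 1) := by
    have : Continuous (fun ε : ℝ => Real.exp (-(2 * ε) / 24)) := by fun_prop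
    simpa using (this.tendsto 0).mono_left nhdsWithin_le_nhds
  have h4 := h3.mul h2
  simp only [inv_one, mul_one] at h4
  refine h4.congr' ?_
  have hne : ∀ᶠ ε in 𝓝[>] (0:ℝ), (∏' n : ℕ, (1 - Real.exp (-(2 * (Real.pi ^ 2 / ε))) ^ (n + 1))) ≠ 0 :=
    (euler_tendsto_one.comp h1).eventually_ne one_ne_zero
  filter_upwards [hne, self_mem_nhdsWithin] with ε hne hε
  have hε : 0 < ε := hε
  have h := euler_prod_eq ε hε
  have hs : 0 < Real.sqrt (ε / Real.pi) := Real.sqrt_pos.mpr (by positivity)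
  have e3 : Real.exp (-(2 * (Real.pi ^ 2 / ε)) / 24) = (Real.exp (Real.pi ^ 2 / 12 / ε))⁻¹ := by
    rw [← Real.exp_neg]; congr 1; ring
  rw [e3] at h
  have hX := Real.exp_pos (Real.pi ^ 2 / 12 / ε)
  have hY := Real.exp_pos (-(2 * ε) / 24)
  simp only [Function.comp]
  generalize (∏' n : ℕ, (1 - Real.exp (-(2 * (Real.pi ^ 2 / ε))) ^ (n + 1))) = a at *
  generalize (∏' n : ℕ, (1 - Real.exp (-(2 * ε)) ^ (n + 1))) = b at *
  have hb : b ≠ 0 := by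
    rintro rfl
    simp at h
    exact hne h
  field_simp at h ⊢
  linarith

noncomputable def gg (x : ℝ) : ℝ := Real.log (1 + Real.exp (-x) - Real.exp (-x) ^ 2)
noncomputable def gg' (x : ℝ) : ℝ :=
  (-Real.exp (-x) + 2 * Real.exp (-x) ^ 2) / (1 + Real.exp (-x) - Real.exp (-x) ^ 2)
noncomputable def gg'' (x : ℝ) : ℝ :=
  ((Real.exp (-x) - 4 * Real.exp (-x) ^ 2) * (1 + Real.exp (-x) - Real.exp (-x) ^ 2) -
    (-Real.exp (-x) + 2 * Real.exp (-x) ^ 2) * (-Real.exp (-x) + 2 * Real.exp (-x) ^ 2)) /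
   (1 + Real.exp (-x) - Real.exp (-x) ^ 2) ^ 2

lemma yle {x : ℝ} (hx : 0 ≤ x) : Real.exp (-x) ≤ 1 := by
  rw [Real.exp_le_one_iff]; linarith

lemma uge {x : ℝ} (hx : 0 ≤ x) : 1 ≤ 1 + Real.exp (-x) - Real.exp (-x) ^ 2 := by
  nlinarith [yle hx, Real.exp_pos (-x)]

lemma hasDerivAt_y (x : ℝ) : HasDerivAt (fun x : ℝ => Real.exp (-x)) (-Real.exp (-x)) x := by
  have := (hasDerivAt_neg x).exp
  simpa using this

lemma hasDerivAt_gg {x : ℝ} (hx : 0 ≤ x) : HasDerivAt gg (gg' x) x := by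
  have h := hasDerivAt_y x
  have h2 := ((h.const_add 1).sub (h.pow 2)).log (by have := uge hx; simp; linarith)
  refine h2.congr_deriv ?_
  unfold gg'
  simp
  ring

lemma hasDerivAt_gg' {x : ℝ} (hx : 0 ≤ x) : HasDerivAt gg' (gg'' x) x := by
  have h := hasDerivAt_y x
  have h2 := (h.neg.add ((h.pow 2).const_mul 2)).div ((h.const_add 1).sub (h.pow 2)) (by have := uge hx; simp; linarith)
  refine h2.congr_deriv ?_
  unfold gg''
  simp
  congr 1
  ring

lemma gg''_bound {a x : ℝ} (ha : 0 ≤ a) (hx : a ≤ x) : |gg'' x| ≤ 10 * Real.exp (-a) := by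
  have h0 : 0 ≤ x := ha.trans hx
  have h1 := uge h0
  have h2 := yle h0
  have h3 := Real.exp_pos (-x)
  have h4 : Real.exp (-x) ≤ Real.exp (-a) := by rw [Real.exp_le_exp]; linarith
  unfold gg''
  set y := Real.exp (-x)
  refine le_trans ?_ (mul_le_mul_of_nonneg_left h4 (by norm_num : (0:ℝ) ≤ 10))
  rw [abs_div, abs_of_pos (by positivity : 0 < (1 + y - y ^ 2) ^ 2)]
  apply div_le_of_le_mul₀ (by positivity) (by positivity)
  have h5 : 1 ≤ (1 + y - y ^ 2) ^ 2 := one_le_pow₀ h1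
  have h6 : 10 * y * 1 ≤ 10 * y * (1 + y - y ^ 2) ^ 2 := by
    apply mul_le_mul_of_nonneg_left h5; positivity
  refine le_trans ?_ h6
  have e : (y - 4 * y ^ 2) * (1 + y - y ^ 2) - (-y + 2 * y ^ 2) * (-y + 2 * y ^ 2) = y * ((1 - 4 * y) * (1 + y - y ^ 2) - y * (1 - 2 * y) ^ 2) := by ring
  rw [e, abs_mul, abs_of_pos h3, mul_one, mul_comm 10 y]
  apply mul_le_mul_of_nonneg_left _ h3.le
  rw [abs_le]
  have : y * y ≤ y := by nlinarith
  constructor <;> nlinarith [mul_nonneg h3.le (sub_nonneg.2 h2), mul_nonneg (mul_nonneg h3.le h3.le) (sub_nonneg.2 h2)]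

lemma gg_nonneg {x : ℝ} (hx : 0 ≤ x) : 0 ≤ gg x := Real.log_nonneg (uge hx)

lemma gg_le {x : ℝ} (hx : 0 ≤ x) : gg x ≤ Real.exp (-x) := by
  have := Real.log_le_sub_one_of_pos (lt_of_lt_of_le one_pos (uge hx))
  unfold gg
  nlinarith [sq_nonneg (Real.exp (-x))]

lemma gg_cont : ContinuousOn gg (Set.Ici 0) :=
  fun _ hx => (hasDerivAt_gg hx).continuousAt.continuousWithinAt

lemma gg_int {a b : ℝ} (ha : 0 ≤ a) (hb : 0 ≤ b) : IntervalIntegrable gg MeasureTheory.volume a b := by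
  apply ContinuousOn.intervalIntegrable
  apply gg_cont.mono
  intro x hx
  rcases Set.mem_uIcc.1 hx with h | h
  · exact ha.trans h.1
  · exact hb.trans h.1

lemma trap (a e : ℝ) (ha : 0 ≤ a) (he : 0 ≤ e) :
    |(∫ x in a..(a+e), gg x) - e / 2 * (gg a + gg (a + e))| ≤ 5 * e ^ 3 * Real.exp (-a) := by
  set K := 10 * Real.exp (-a) with hK
  have hK0 : 0 ≤ K := by positivity
  set h : ℝ → ℝ := fun t => (∫ x in a..(a+t), gg x) - t / 2 * (gg a + gg (a + t)) with hh
  have hd : ∀ t ∈ Set.Icc 0 e, HasDerivWithinAt h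
      (gg (a+t) - (1 / 2 * (gg a + gg (a+t)) + t / 2 * gg' (a + t))) (Set.Icc 0 e) t := by
    intro t ht
    have hat : 0 ≤ a + t := add_nonneg ha ht.1
    have hc : ContinuousWithinAt gg (Set.Icc a (a+e)) (a+t) := 
      (hasDerivAt_gg hat).continuousAt.continuousWithinAt
    have hmem : a + t ∈ Set.Icc a (a+e) := ⟨by linarith [ht.1], by linarith [ht.2]⟩
    have : Fact (a + t ∈ Set.Icc a (a+e)) := ⟨hmem⟩
    have h1 : HasDerivWithinAt (fun u => ∫ x in a..u, gg x) (gg (a+t)) (Set.Icc a (a+e)) (a+t) := by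
      apply intervalIntegral.integral_hasDerivWithinAt_right (gg_int ha hat)
      · exact (gg_cont.stronglyMeasurableAtFilter_nhdsWithin measurableSet_Ici _).filter_mono
          (nhdsWithin_mono _ (fun x hx => ha.trans hx.1))
      · exact hc
    have h2 : HasDerivWithinAt (fun t : ℝ => a + t) 1 (Set.Icc 0 e) t :=
      ((hasDerivAt_id t).const_add a).hasDerivWithinAt
    have h3 := h1.scomp t h2 (fun s hs => ⟨by linarith [hs.1], by linarith [hs.2]⟩)
    have h4 : HasDerivAt (fun t => gg (a+t)) (gg' (a+t)) t := by
      simpa using (hasDerivAt_gg hat).comp_const_add a t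
    have h5 := (((hasDerivAt_id t).div_const 2).mul (h4.const_add (gg a))).hasDerivWithinAt (s := Set.Icc 0 e)
    have h6 := h3.sub h5
    refine h6.congr_deriv ?_
    simp
  have hb : ∀ t ∈ Set.Icc 0 e, ‖gg (a+t) - (1 / 2 * (gg a + gg (a+t)) + t / 2 * gg' (a + t))‖ ≤ K * e ^ 2 / 2 := by
    intro t ht
    have hlip : ∀ s ∈ Set.Icc a (a+t), |gg' s - gg' (a+t)| ≤ K * t := by
      intro s hs
      have := (convex_Icc a (a+t)).norm_image_sub_le_of_norm_hasDerivWithin_le (f := gg') (f' := gg'') (C := K)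
        (x := a + t) (y := s)
        (fun x hx => (hasDerivAt_gg' (ha.trans hx.1)).hasDerivWithinAt)
        (fun x hx => gg''_bound ha hx.1) ⟨by linarith [ht.1], le_rfl⟩ hs
      refine this.trans ?_
      apply mul_le_mul_of_nonneg_left _ hK0
      rw [Real.norm_eq_abs, abs_le]
      constructor <;> linarith [hs.1, hs.2]
    have := (convex_Icc a (a+t)).norm_image_sub_le_of_norm_hasDerivWithin_le
        (f := fun x => gg x - gg' (a+t) * x) (f' := fun x => gg' x - gg' (a+t)) (C := K * t)
        (x := a) (y := a+t)
        (fun x hx => by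
          have := (hasDerivAt_gg (ha.trans hx.1)).fun_sub ((hasDerivAt_id x).const_mul (gg' (a+t)))
          simpa using this.hasDerivWithinAt)
        hlip ⟨le_rfl, by linarith [ht.1]⟩ ⟨by linarith [ht.1], le_rfl⟩
    have e1 : gg (a+t) - (1 / 2 * (gg a + gg (a+t)) + t / 2 * gg' (a + t)) =
      1 / 2 * (gg (a + t) - gg' (a+t) * (a+t) - (gg a - gg' (a+t) * a)) := by ring
    rw [e1, norm_mul]
    have e2 : ‖a + t - a‖ = t := by rw [add_sub_cancel_left, Real.norm_eq_abs, abs_of_nonneg ht.1]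
    rw [e2] at this
    have e3 : ‖(1/2 : ℝ)‖ = 1 / 2 := by norm_num
    rw [e3]
    have : t * t ≤ e * e := mul_self_le_mul_self ht.1 ht.2
    nlinarith
  have := (convex_Icc 0 e).norm_image_sub_le_of_norm_hasDerivWithin_le hd hb ⟨le_rfl, he⟩ ⟨he, le_rfl⟩
  have h0 : h 0 = 0 := by simp [hh]
  rw [h0, sub_zero, sub_zero, Real.norm_eq_abs, Real.norm_eq_abs, abs_of_nonneg he] at this
  refine this.trans (le_of_eq ?_)
  rw [hK]; ring

lemma trap_sum (ε : ℝ) (hε : 0 < ε) (N : ℕ) :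
    |(∫ x in (0:ℝ)..(N * ε), gg x) - ε * ((∑ i ∈ Finset.range N, gg ((i + 1 : ℕ) * ε)) - gg (N * ε) / 2)|
      ≤ 5 * ε ^ 3 * ∑ i ∈ Finset.range N, Real.exp (-ε) ^ i := by
  induction N with
  | zero => simp [gg]
  | succ N ih =>
    have hN : 0 ≤ N * ε := by positivity
    have h := trap (N * ε) ε hN hε.le
    have e1 : (N : ℝ) * ε + ε = (N + 1 : ℕ) * ε := by push_cast; ring
    rw [e1] at h
    have e2 := intervalIntegral.integral_add_adjacent_intervals (gg_int (le_refl 0) hN)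
      (gg_int hN (by positivity : 0 ≤ (N + 1 : ℕ) * ε))
    rw [← e2, Finset.sum_range_succ, Finset.sum_range_succ, mul_add]
    have e3 : Real.exp (-ε) ^ N = Real.exp (-(N * ε)) := by
      rw [← Real.exp_nat_mul]; congr 1; ring
    rw [e3]
    refine le_trans (le_of_eq ?_) ((abs_add_le _ _).trans (add_le_add ih h))
    congr 1
    ring

lemma gg_summable (ε : ℝ) (hε : 0 < ε) : Summable (fun i : ℕ => gg ((i + 1 : ℕ) * ε)) := by
  refine Summable.of_nonneg_of_le (fun i => gg_nonneg (by positivity)) (fun i => gg_le (by positivity)) ?_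
  have : ∀ i : ℕ, Real.exp (-((i + 1 : ℕ) * ε)) = Real.exp (-ε) ^ (i + 1) := by
    intro i
    rw [← Real.exp_nat_mul]; congr 1; ring
  simp_rw [this]
  exact (summable_nat_add_iff 1).2 (summable_geometric_of_lt_one (Real.exp_pos _).le (by simpa using hε))

lemma gg_bound (I : ℝ) (hI : Tendsto (fun X : ℝ => ∫ x in (0:ℝ)..X, gg x) atTop (𝓝 I)) (ε : ℝ) (hε : 0 < ε) :
    |(∑' i : ℕ, gg ((i + 1 : ℕ) * ε)) - I / ε| ≤ 5 * ε * Real.exp ε := by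
  have hN : Tendsto (fun N : ℕ => (N : ℝ) * ε) atTop atTop :=
    tendsto_natCast_atTop_atTop.atTop_mul_const hε
  have h1 := hI.comp hN
  have h2 := (gg_summable ε hε).hasSum.tendsto_sum_nat
  have h3 : Tendsto (fun N : ℕ => gg (N * ε)) atTop (𝓝 0) := by
    refine squeeze_zero (fun N => gg_nonneg (by positivity)) (fun N => gg_le (by positivity)) ?_
    exact Real.tendsto_exp_neg_atTop_nhds_zero.comp hN
  have h4 := (h1.sub ((h2.sub (h3.div_const 2)).const_mul ε)).abs
  have hq : Real.exp (-ε) < 1 := by simpa using hε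
  have h5 : |I - ε * ((∑' i : ℕ, gg ((i + 1 : ℕ) * ε)) - 0 / 2)| ≤ 5 * ε ^ 3 * (1 - Real.exp (-ε))⁻¹ := by
    refine le_of_tendsto h4 (Eventually.of_forall fun N => (trap_sum ε hε N).trans ?_)
    rw [← tsum_geometric_of_lt_one (Real.exp_pos _).le hq]
    apply mul_le_mul_of_nonneg_left _ (by positivity)
    exact (summable_geometric_of_lt_one (Real.exp_pos _).le hq).sum_le_tsum _ (fun i _ => by positivity)
  have h6 : ε * Real.exp (-ε) ≤ 1 - Real.exp (-ε) := by
    have := Real.add_one_le_exp ε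
    have h7 : Real.exp ε * Real.exp (-ε) = 1 := by rw [← Real.exp_add]; simp
    nlinarith [Real.exp_pos (-ε)]
  have h8 : (1 - Real.exp (-ε))⁻¹ ≤ (ε * Real.exp (-ε))⁻¹ := inv_anti₀ (by positivity) h6
  have h9 : |(∑' i : ℕ, gg ((i + 1 : ℕ) * ε)) - I / ε| = |I - ε * ((∑' i : ℕ, gg ((i + 1 : ℕ) * ε)) - 0 / 2)| / ε := by
    rw [abs_sub_comm I, ← abs_of_pos hε, ← abs_div, abs_of_pos hε]
    congr 1
    field_simp
    ring
  rw [h9, div_le_iff₀ hε]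
  refine h5.trans ((mul_le_mul_of_nonneg_left h8 (by positivity)).trans (le_of_eq ?_))
  rw [mul_inv, Real.exp_neg, inv_inv]
  field_simp

noncomputable def uu0 : ℝ := Real.log ((1 + Real.sqrt 5) / 2)

lemma uu0_nonneg : 0 ≤ uu0 := by
  apply Real.log_nonneg
  have : (1:ℝ) ≤ Real.sqrt 5 := by rw [Real.one_le_sqrt]; norm_num
  linarith

lemma sinh_uu0 : Real.sinh uu0 = 1 / 2 := by
  have h5 : Real.sqrt 5 ^ 2 = 5 := Real.sq_sqrt (by norm_num)
  have hpos : 0 < Real.sqrt 5 := Real.sqrt_pos.2 (by norm_num)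
  rw [Real.sinh_eq, uu0, Real.exp_neg, Real.exp_log (by positivity)]
  field_simp
  nlinarith

noncomputable def kerr (y u : ℝ) : ℝ :=
  8 * Real.sinh u * Real.cosh u / (1 + 4 * Real.sinh u ^ 2 * |y * (1 - y)|)

lemma ker_cont : Continuous (fun p : ℝ × ℝ => kerr p.1 p.2) := by
  unfold kerr
  apply Continuous.div (by fun_prop) (by fun_prop)
  intro p
  positivity

noncomputable def kap (y : ℝ) : ℝ := ∫ u in (0:ℝ)..uu0, kerr y u

lemma kap_cont : Continuous kap := by
  apply intervalIntegral.continuous_parametric_intervalIntegral_of_continuous' (f := kerr)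
  exact ker_cont

lemma kap_symm (y : ℝ) : kap (1 - y) = kap y := by
  unfold kap kerr
  congr 1
  ext u
  congr 4
  ring

lemma kap_mul {y : ℝ} (h0 : 0 ≤ y) (h1 : y ≤ 1) : y * (1 - y) * kap y = Real.log (1 + y * (1 - y)) := by
  have hw : 0 ≤ y * (1 - y) := mul_nonneg h0 (by linarith)
  unfold kap
  rw [← intervalIntegral.integral_const_mul]
  have hd : ∀ u ∈ Set.uIcc 0 uu0, HasDerivAt (fun u => Real.log (1 + 4 * Real.sinh u ^ 2 * (y * (1 - y))))
      (y * (1 - y) * kerr y u) u := by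
    intro u _
    have h := (((((Real.hasDerivAt_sinh u).pow 2).const_mul 4).mul_const (y * (1 - y))).const_add 1).log
      (by simp only [Pi.pow_apply]; positivity)
    refine h.congr_deriv ?_
    unfold kerr
    rw [abs_of_nonneg hw]
    simp
    ring
  rw [intervalIntegral.integral_eq_sub_of_hasDerivAt hd]
  · rw [sinh_uu0]; norm_num
  · apply Continuous.intervalIntegrable
    have : Continuous (fun u => kerr y u) := ker_cont.comp (by fun_prop : Continuous fun u : ℝ => (y, u))
    fun_prop

lemma ker_int (u : ℝ) : ∫ y in (0:ℝ)..1, kerr y u = 8 * u := by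
  have hcs := Real.cosh_sq u
  have hc := Real.cosh_pos u
  have h1 : 0 < Real.cosh u + Real.sinh u := by rw [Real.cosh_add_sinh]; positivity
  have h2 : 0 < Real.cosh u - Real.sinh u := by rw [Real.cosh_sub_sinh]; positivity
  have hd : ∀ y ∈ Set.uIcc (0:ℝ) 1, HasDerivAt (fun y => 2 * (Real.log (Real.cosh u + Real.sinh u * (2 * y - 1))
      - Real.log (Real.cosh u - Real.sinh u * (2 * y - 1)))) (kerr y u) y := by
    intro y hy
    rw [Set.uIcc_of_le zero_le_one] at hy
    have hw : 0 ≤ y * (1 - y) := mul_nonneg hy.1 (by linarith [hy.2])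
    have p1 : 0 < Real.cosh u + Real.sinh u * (2 * y - 1) := by
      rcases lt_or_ge 0 y with h | h
      · nlinarith [hy.1, hy.2]
      · have : y = 0 := le_antisymm h hy.1
        subst this; linarith
    have p2 : 0 < Real.cosh u - Real.sinh u * (2 * y - 1) := by
      rcases lt_or_ge 0 y with h | h
      · nlinarith [hy.1, hy.2]
      · have : y = 0 := le_antisymm h hy.1
        subst this; linarith
    have hl : HasDerivAt (fun y : ℝ => Real.sinh u * (2 * y - 1)) (Real.sinh u * 2) y := by
      have := (((hasDerivAt_id y).const_mul 2).sub_const 1).const_mul (Real.sinh u)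
      simpa using this
    have h := (((hl.const_add (Real.cosh u)).log p1.ne').sub ((hl.const_sub (Real.cosh u)).log p2.ne')).const_mul 2
    refine h.congr_deriv ?_
    unfold kerr
    rw [abs_of_nonneg hw]
    have e : 1 + 4 * Real.sinh u ^ 2 * (y * (1 - y)) =
      (Real.cosh u + Real.sinh u * (2 * y - 1)) * (Real.cosh u - Real.sinh u * (2 * y - 1)) := by
      ring_nf; rw [hcs]; ring
    rw [e]
    field_simp
    ring
  rw [intervalIntegral.integral_eq_sub_of_hasDerivAt hd]
  · have e1 : Real.cosh u + Real.sinh u * (2 * 1 - 1) = Real.exp u := by rw [← Real.cosh_add_sinh]; ring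
    have e2 : Real.cosh u - Real.sinh u * (2 * 1 - 1) = Real.exp (-u) := by rw [← Real.cosh_sub_sinh]; ring
    have e3 : Real.cosh u + Real.sinh u * (2 * 0 - 1) = Real.exp (-u) := by rw [← Real.cosh_sub_sinh]; ring
    have e4 : Real.cosh u - Real.sinh u * (2 * 0 - 1) = Real.exp u := by rw [← Real.cosh_add_sinh]; ring
    rw [e1, e2, e3, e4, Real.log_exp, Real.log_exp]
    ring
  · apply Continuous.intervalIntegrable
    exact ker_cont.comp (by fun_prop : Continuous fun y : ℝ => (y, u))

lemma kap_int : ∫ y in (0:ℝ)..1, kap y = 4 * uu0 ^ 2 := by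
  unfold kap
  rw [MeasureTheory.intervalIntegral_intervalIntegral_swap]
  · simp_rw [ker_int]
    rw [intervalIntegral.integral_const_mul, integral_id]
    ring
  · have : MeasureTheory.IntegrableOn (Function.uncurry kerr) (Set.uIcc 0 1 ×ˢ Set.uIcc 0 uu0) := by
      apply ContinuousOn.integrableOn_compact (isCompact_uIcc.prod isCompact_uIcc)
      exact Continuous.continuousOn ker_cont
    exact this.mono_set (Set.prod_mono Set.uIoc_subset_uIcc Set.uIoc_subset_uIcc)

lemma kap_int' : ∫ y in (0:ℝ)..1, (1 - y) * kap y = 2 * uu0 ^ 2 := by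
  have h1 : ∫ y in (0:ℝ)..1, (1 - y) * kap y = ∫ y in (0:ℝ)..1, y * kap y := by
    have := intervalIntegral.integral_comp_sub_left (a := 0) (b := 1) (fun y => y * kap y) 1
    simp only [kap_symm] at this
    rw [this]; norm_num
  have h2 : (∫ y in (0:ℝ)..1, (1 - y) * kap y) + ∫ y in (0:ℝ)..1, y * kap y = 4 * uu0 ^ 2 := by
    have hk := kap_cont
    rw [← intervalIntegral.integral_add, ← kap_int]
    · congr 1; ext y; ring
    · apply Continuous.intervalIntegrable; fun_prop
    · apply Continuous.intervalIntegrable; fun_prop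
  linarith

lemma gg_integral : Tendsto (fun X : ℝ => ∫ x in (0:ℝ)..X, gg x) atTop (𝓝 (2 * uu0 ^ 2)) := by
  have hk := kap_cont
  have hc : Continuous (fun y => (1 - y) * kap y) := by fun_prop
  have hM : ∀ t : ℝ, HasDerivAt (fun t => ∫ y in (1:ℝ)..t, (1 - y) * kap y) ((1 - t) * kap t) t :=
    fun t => intervalIntegral.integral_hasDerivAt_right (hc.intervalIntegrable _ _)
      (hc.stronglyMeasurableAtFilter _ _) hc.continuousAt
  have hMc : Continuous (fun t => ∫ y in (1:ℝ)..t, (1 - y) * kap y) :=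
    continuous_iff_continuousAt.2 fun t => (hM t).continuousAt
  have h1 : Tendsto (fun X : ℝ => - ∫ y in (1:ℝ)..(Real.exp (-X)), (1 - y) * kap y) atTop (𝓝 (2 * uu0 ^ 2)) := by
    have := ((hMc.tendsto 0).comp Real.tendsto_exp_neg_atTop_nhds_zero).neg
    rw [intervalIntegral.integral_symm, kap_int', neg_neg] at this
    exact this
  refine h1.congr' ?_
  filter_upwards [eventually_ge_atTop 0] with X hX
  have hd : ∀ x ∈ Set.uIcc 0 X, HasDerivAt (fun X : ℝ => - ∫ y in (1:ℝ)..(Real.exp (-X)), (1 - y) * kap y) (gg x) x := by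
    intro x hx
    rw [Set.uIcc_of_le hX] at hx
    have h2 : HasDerivAt (fun x : ℝ => Real.exp (-x)) (-Real.exp (-x)) x := by
      simpa using (hasDerivAt_neg x).exp
    have h3 := ((hM (Real.exp (-x))).comp x h2).neg
    refine h3.congr_deriv ?_
    have h4 := kap_mul (Real.exp_pos (-x)).le (by rw [Real.exp_le_one_iff]; linarith [hx.1])
    unfold gg
    have : 1 + Real.exp (-x) - Real.exp (-x) ^ 2 = 1 + Real.exp (-x) * (1 - Real.exp (-x)) := by ring
    rw [this, ← h4]
    ring
  rw [intervalIntegral.integral_eq_sub_of_hasDerivAt hd (gg_int le_rfl hX)]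
  simp

def PR (a b : ℕ) : Prop := a = b ∨ (a < b ∧ (Odd a ↔ Even b))

lemma PR_add (c a b : ℕ) : PR (a + c) (b + c) ↔ PR a b := by
  unfold PR
  have : (Odd (a + c) ↔ Even (b + c)) ↔ (Odd a ↔ Even b) := by
    simp only [Nat.odd_iff, Nat.even_iff]; omega
  rw [this]
  constructor <;> rintro (h | h)
  · left; omega
  · right; exact ⟨by omega, h.2⟩
  · left; omega
  · right; exact ⟨by omega, h.2⟩

lemma PR_le {a b : ℕ} (h : PR a b) : a ≤ b := by
  rcases h with h | h
  · exact h.le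
  · exact h.1.le

def EE : List ℕ → List ℕ
  | [] => []
  | e :: es => (0 :: EE es).map (· + (2 * e - 1))

def LL (t : ℕ × List ℕ) : List ℕ := (0 :: EE t.2).map (· + (t.1 + 1))

lemma chain_shift (c : ℕ) (l : List ℕ) : (l.map (· + c)).IsChain PR ↔ l.IsChain PR := by
  rw [List.isChain_map]
  simp only [PR_add]

lemma EE_chain (es : List ℕ) : (0 :: EE es).IsChain PR := by
  induction es with
  | nil => simp [EE]
  | cons e es ih =>
    have h := (chain_shift (2 * e - 1) _).2 ih
    rw [EE]
    rw [List.map_cons] at h ⊢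
    refine List.isChain_cons_cons.2 ⟨?_, h⟩
    rcases Nat.eq_zero_or_pos e with h0 | h0
    · left; omega
    · right
      refine ⟨by omega, ?_⟩
      simp only [Nat.odd_iff, Nat.even_iff]; omega

lemma LL_chain (t : ℕ × List ℕ) : (LL t).IsChain PR := (chain_shift _ _).2 (EE_chain _)

lemma chain_pairwise {l : List ℕ} (h : l.IsChain PR) : l.Pairwise (· ≤ ·) := by
  rw [← List.isChain_iff_pairwise]
  exact h.imp (fun _ _ => PR_le)

lemma unshift {c : ℕ} {l : List ℕ} (h : (c :: l).IsChain PR) :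
    ∃ l', l'.length = l.length ∧ (0 :: l').IsChain PR ∧ (0 :: l').map (· + c) = c :: l := by
  have hp := List.pairwise_cons.1 (chain_pairwise h)
  have e : (0 :: l.map (· - c)).map (· + c) = c :: l := by
    rw [List.map_cons, List.map_map]
    simp only [zero_add, List.cons.injEq, true_and]
    conv_rhs => rw [← List.map_id l]
    apply List.map_congr_left
    intro a ha
    have := hp.1 a ha
    simp; omega
  refine ⟨l.map (· - c), by simp, ?_, e⟩
  rw [← chain_shift c, e]
  exact h

lemma EE_surj (n : ℕ) : ∀ l : List ℕ, l.length = n → (0 :: l).IsChain PR → ∃ es, EE es = l := by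
  induction n with
  | zero =>
    intro l hl _
    exact ⟨[], by rw [List.length_eq_zero_iff.1 hl]; rfl⟩
  | succ n ih =>
    intro l hl h
    rcases l with _ | ⟨c, l⟩
    · simp at hl
    obtain ⟨h1, h2⟩ := List.isChain_cons_cons.1 h
    obtain ⟨l', hl', hc, he⟩ := unshift h2
    obtain ⟨es, hes⟩ := ih l' (by simp at hl; omega) hc
    refine ⟨(c + 1) / 2 :: es, ?_⟩
    rw [EE, hes]
    have : 2 * ((c + 1) / 2) - 1 = c := by
      rcases h1 with h1 | h1
      · omega
      · have := h1.2
        simp only [Nat.odd_iff, Nat.even_iff] at this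
        omega
    rw [this, he]

lemma LL_surj (l : List ℕ) (hne : l ≠ []) (hpos : ∀ a ∈ l, 0 < a) (h : l.IsChain PR) :
    ∃ t, LL t = l := by
  rcases l with _ | ⟨c, l⟩
  · simp at hne
  obtain ⟨l', hl', hc, he⟩ := unshift h
  obtain ⟨es, hes⟩ := EE_surj _ l' rfl hc
  refine ⟨(c - 1, es), ?_⟩
  have : c - 1 + 1 = c := by have := hpos c (by simp); omega
  simp only [LL, hes, this, he]

lemma map_add_inj (c : ℕ) : Function.Injective (List.map (· + c)) :=
  List.map_injective_iff.2 (add_left_injective c)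

lemma EE_inj : Function.Injective EE := by
  intro es
  induction es with
  | nil =>
    intro es' h
    rcases es' with _ | ⟨e', es'⟩
    · rfl
    · simp [EE] at h
  | cons e es ih =>
    intro es' h
    rcases es' with _ | ⟨e', es'⟩
    · simp [EE] at h
    · rw [EE, EE, List.map_cons, List.map_cons, List.cons.injEq] at h
      obtain ⟨h1, h2⟩ := h
      have : e = e' := by omega
      subst this
      rw [ih (map_add_inj _ h2)]

lemma LL_inj : Function.Injective LL := by
  rintro ⟨e, es⟩ ⟨e', es'⟩ h
  simp only [LL, List.map_cons, List.cons.injEq] at h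
  obtain ⟨h1, h2⟩ := h
  have : e = e' := by omega
  subst this
  rw [EE_inj (map_add_inj _ h2)]

def PAL (l : List ℕ) : Prop := ∀ a ∈ l, ∀ b ∈ l, a < b →
    (∀ c ∈ l, ¬(a < c ∧ c < b)) → (Odd a ↔ Even b)

lemma PAL_of_chain : ∀ l : List ℕ, l.IsChain PR → PAL l
  | [], _ => by intro a ha; simp at ha
  | [x], _ => by
    intro a ha b hb hab
    simp at ha hb; omega
  | x :: y :: l, h => by
    obtain ⟨h1, h2⟩ := List.isChain_cons_cons.1 h
    have ih := PAL_of_chain (y :: l) h2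
    have hp := chain_pairwise h2
    have hxy := PR_le h1
    have hy : ∀ z ∈ y :: l, y ≤ z := by
      intro z hz
      rcases List.mem_cons.1 hz with rfl | hz
      · exact le_rfl
      · exact (List.pairwise_cons.1 hp).1 z hz
    intro a ha b hb hab hc
    have hb' : b ∈ y :: l := by
      rcases List.mem_cons.1 hb with rfl | hb
      · rcases List.mem_cons.1 ha with rfl | ha
        · omega
        · have := hy a ha; omega
      · exact hb
    by_cases ha' : a ∈ y :: l
    · exact ih a ha' b hb' hab (fun c hc' => hc c (List.mem_cons_of_mem _ hc'))
    · have hax : a = x := by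
        rcases List.mem_cons.1 ha with h | h
        · exact h
        · exact absurd h ha'
      subst hax
      rcases h1 with h1 | h1
      · exact absurd (by rw [h1]; simp) ha'
      · have hyb := hy b hb'
        have := hc y (by simp)
        have : b = y := by omega
        subst this
        exact h1.2

lemma chain_of_PAL : ∀ l : List ℕ, l.Pairwise (· ≤ ·) → PAL l → l.IsChain PR
  | [], _, _ => by simp
  | [x], _, _ => by simp
  | x :: y :: l, hs, h => by
    obtain ⟨hs1, hs2⟩ := List.pairwise_cons.1 hs
    have hy : ∀ z ∈ y :: l, y ≤ z := by
      intro z hz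
      rcases List.mem_cons.1 hz with rfl | hz
      · exact le_rfl
      · exact (List.pairwise_cons.1 hs2).1 z hz
    refine List.isChain_cons_cons.2 ⟨?_, chain_of_PAL (y :: l) hs2 ?_⟩
    · have hxy := hs1 y (by simp)
      rcases hxy.eq_or_lt with h0 | h0
      · exact Or.inl h0
      · refine Or.inr ⟨h0, h x (by simp) y (by simp) h0 ?_⟩
        intro c hc
        rcases List.mem_cons.1 hc with rfl | hc
        · omega
        · have := hy c hc; omega
    · intro a ha b hb hab hc
      refine h a (List.mem_cons_of_mem _ ha) b (List.mem_cons_of_mem _ hb) hab ?_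
      intro c hc'
      rcases List.mem_cons.1 hc' with rfl | hc'
      · have := hs1 a ha; omega
      · exact hc c hc'

lemma LL_pos (t : ℕ × List ℕ) : ∀ a ∈ LL t, 0 < a := by
  intro a ha
  rw [LL, List.mem_map] at ha
  obtain ⟨b, _, rfl⟩ := ha
  omega

def toPart {n : ℕ} (t : {t : ℕ × List ℕ // (LL t).sum = n}) : {p : n.Partition // ParityAlternating p} :=
  ⟨⟨(LL t.1 : Multiset ℕ), fun {a} ha => LL_pos t.1 a (by simpa using ha), by simpa using t.2⟩,
    PAL_of_chain _ (LL_chain t.1)⟩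

lemma toPart_bij (n : ℕ) : Function.Bijective (toPart (n := n + 1)) := by
  constructor
  · rintro ⟨t, ht⟩ ⟨t', ht'⟩ h
    have h' : (LL t : Multiset ℕ) = (LL t' : Multiset ℕ) := congrArg (fun p => p.1.parts) h
    have := (Multiset.coe_eq_coe.1 h').eq_of_pairwise (fun a b _ _ => le_antisymm) (chain_pairwise (LL_chain t)) (chain_pairwise (LL_chain t'))
    exact Subtype.ext (LL_inj this)
  · rintro ⟨p, hp⟩
    have hs := Multiset.pairwise_sort p.parts (· ≤ ·)
    have he := Multiset.sort_eq p.parts (· ≤ ·)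
    have hmem : ∀ a, a ∈ p.parts.sort (· ≤ ·) ↔ a ∈ p.parts := fun a => Multiset.mem_sort _
    have hsum : (p.parts.sort (· ≤ ·)).sum = n + 1 := by
      rw [← Multiset.sum_coe, he, p.parts_sum]
    obtain ⟨t, ht⟩ := LL_surj (p.parts.sort (· ≤ ·))
      (by intro h0; rw [h0] at hsum; simp at hsum)
      (fun a ha => p.parts_pos ((hmem a).1 ha))
      (chain_of_PAL _ hs (by
        intro a ha b hb hab hc
        rw [hmem] at ha hb
        exact hp a ha b hb hab (fun c hc' => hc c ((hmem c).2 hc'))))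
    refine ⟨⟨t, by rw [ht, hsum]⟩, ?_⟩
    apply Subtype.ext
    apply Nat.Partition.ext
    simp only [toPart, ht, he]

lemma pa_eq (n : ℕ) : pa (n + 1) = Nat.card {t : ℕ × List ℕ // (LL t).sum = n + 1} :=
  (Nat.card_congr (Equiv.ofBijective _ (toPart_bij n))).symm

lemma fib_finite (n : ℕ) : Finite {t : ℕ × List ℕ // (LL t).sum = n + 1} :=
  Finite.of_injective _ (toPart_bij n).1

lemma EE_length (es : List ℕ) : (EE es).length = es.length := by
  induction es with
  | nil => rfl
  | cons e es ih => simp [EE, ih]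

lemma sum_shift (c : ℕ) (l : List ℕ) : (l.map (· + c)).sum = l.sum + l.length * c := by
  simp [List.sum_map_add]

lemma EE_sum (e : ℕ) (es : List ℕ) : (EE (e :: es)).sum = (EE es).sum + (es.length + 1) * (2 * e - 1) := by
  rw [EE, sum_shift]; simp [EE_length]

lemma LL_sum (e : ℕ) (es : List ℕ) : (LL (e, es)).sum = (EE es).sum + (es.length + 1) * (e + 1) := by
  rw [LL, sum_shift]; simp [EE_length]

open scoped ENNReal

lemma gf_fiber (q : ℝ≥0∞) : ∑' n : ℕ, (pa (n + 1) : ℝ≥0∞) * q ^ (n + 1) = ∑' t : ℕ × List ℕ, q ^ (LL t).sum := by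
  have h1 : ∑' t : ℕ × List ℕ, q ^ (LL t).sum = 
      ∑' n : ℕ, ∑' t : {t : ℕ × List ℕ // (LL t).sum - 1 = n}, q ^ (LL t.1).sum := by
    rw [← (Equiv.sigmaFiberEquiv (fun t : ℕ × List ℕ => (LL t).sum - 1)).tsum_eq, ENNReal.tsum_sigma']
    rfl
  rw [h1]
  congr 1
  ext n
  have hiff : ∀ t : ℕ × List ℕ, (LL t).sum - 1 = n ↔ (LL t).sum = n + 1 := by
    rintro ⟨e, es⟩
    have : 0 < (LL (e, es)).sum := by rw [LL_sum]; positivity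
    omega
  have h2 : ∀ t : {t : ℕ × List ℕ // (LL t).sum - 1 = n}, q ^ (LL t.1).sum = q ^ (n + 1) :=
    fun t => by rw [(hiff _).1 t.2]
  simp_rw [h2]
  rw [ENNReal.tsum_const, pa_eq]
  have hf := fib_finite n
  have : Nat.card {t : ℕ × List ℕ // (LL t).sum - 1 = n} = Nat.card {t : ℕ × List ℕ // (LL t).sum = n + 1} :=
    Nat.card_congr (Equiv.subtypeEquivRight hiff)
  have hf' : Finite {t : ℕ × List ℕ // (LL t).sum - 1 = n} :=
    Finite.of_equiv _ (Equiv.subtypeEquivRight hiff).symm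
  rw [← this, ENat.card_eq_coe_natCard]
  simp

noncomputable def SS (q : ℝ≥0∞) (m : ℕ) : ℝ≥0∞ := ∑' es : {l : List ℕ // l.length = m}, q ^ (EE es.1).sum

def consEq (m : ℕ) : ℕ × {l : List ℕ // l.length = m} ≃ {l : List ℕ // l.length = m + 1} where
  toFun p := ⟨p.1 :: p.2.1, by simp [p.2.2]⟩
  invFun l := (l.1.headD 0, ⟨l.1.tail, by simp [l.2]⟩)
  left_inv p := by simp
  right_inv l := by
    rcases l with ⟨_ | ⟨a, l⟩, h⟩
    · simp at h
    · simp

lemma SS_zero (q : ℝ≥0∞) : SS q 0 = 1 := by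
  unfold SS
  rw [tsum_eq_single ⟨[], rfl⟩]
  · simp [EE]
  · rintro ⟨l, hl⟩ h
    exact absurd (Subtype.ext (List.length_eq_zero_iff.1 hl)) h

lemma SS_succ (q : ℝ≥0∞) (m : ℕ) : SS q (m + 1) = (∑' e : ℕ, (q ^ (m + 1)) ^ (2 * e - 1)) * SS q m := by
  unfold SS
  rw [← (consEq m).tsum_eq, ENNReal.tsum_prod', ← ENNReal.tsum_mul_right]
  congr 1; ext e
  rw [← ENNReal.tsum_mul_left]
  congr 1; ext es
  simp only [consEq, Equiv.coe_fn_mk]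
  rw [EE_sum, es.2, pow_add, pow_mul, mul_comm]

lemma gf_total (q : ℝ≥0∞) : ∑' t : ℕ × List ℕ, q ^ (LL t).sum =
    ∑' m : ℕ, (∑' e : ℕ, (q ^ (m + 1)) ^ (e + 1)) * SS q m := by
  have h1 : ∑' t : ℕ × List ℕ, q ^ (LL t).sum = ∑' es : List ℕ, ∑' e : ℕ, q ^ (LL (e, es)).sum := by
    rw [ENNReal.tsum_prod', ENNReal.tsum_comm]
  rw [h1, ← (Equiv.sigmaFiberEquiv (List.length : List ℕ → ℕ)).tsum_eq, ENNReal.tsum_sigma']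
  congr 1; ext m
  unfold SS
  rw [← ENNReal.tsum_mul_left]
  congr 1; ext es
  rw [← ENNReal.tsum_mul_right]
  congr 1; ext e
  simp only [Equiv.sigmaFiberEquiv, Equiv.coe_fn_mk]
  rw [LL_sum, es.2, pow_add, pow_mul, mul_comm]

noncomputable def fac (x : ℝ) : ℝ := 1 + x / (1 - x ^ 2)

noncomputable def PP (q : ℝ) (m : ℕ) : ℝ := ∏ i ∈ Finset.range m, fac (q ^ (i + 1))

noncomputable def aa (q : ℝ) (m : ℕ) : ℝ := q ^ (m + 1) / (1 - q ^ (m + 1)) * PP q m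

lemma xlt {q : ℝ} (h0 : 0 < q) (h1 : q < 1) (m : ℕ) : 0 < q ^ (m + 1) ∧ q ^ (m + 1) < 1 :=
  ⟨by positivity, pow_lt_one₀ h0.le h1 (by omega)⟩

lemma fac_ge {x : ℝ} (h0 : 0 < x) (h1 : x < 1) : 1 + x ≤ fac x := by
  have h2 : 0 < 1 - x ^ 2 := by nlinarith
  unfold fac
  have : x ≤ x / (1 - x ^ 2) := by
    rw [le_div_iff₀ h2]; nlinarith [mul_pos h0 h0, mul_pos (mul_pos h0 h0) h0]
  linarith

lemma PP_pos {q : ℝ} (h0 : 0 < q) (h1 : q < 1) (m : ℕ) : 0 < PP q m := by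
  apply Finset.prod_pos
  intro i _
  have := xlt h0 h1 i
  have := fac_ge this.1 this.2
  linarith [xlt h0 h1 i]

lemma PP_succ (q : ℝ) (m : ℕ) : PP q (m + 1) = PP q m * fac (q ^ (m + 1)) := by
  unfold PP; rw [Finset.prod_range_succ]

lemma geom_odd {x : ℝ} (h0 : 0 < x) (h1 : x < 1) :
    ∑' e : ℕ, (ENNReal.ofReal x) ^ (2 * e - 1) = ENNReal.ofReal (fac x) := by
  have hs : HasSum (fun e : ℕ => x ^ (2 * (e + 1) - 1)) (x / (1 - x ^ 2)) := by
    have := (hasSum_geometric_of_lt_one (by positivity : 0 ≤ x ^ 2) (by nlinarith)).mul_left x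
    have e : (fun e : ℕ => x ^ (2 * (e + 1) - 1)) = fun i => x * (x ^ 2) ^ i := by
      funext e
      rw [← pow_mul, ← pow_succ']
      congr 1
    rw [div_eq_mul_inv, e]
    exact this
  have hs2 : HasSum (fun e : ℕ => x ^ (2 * e - 1)) (fac x) := by
    have := hs.zero_add (f := fun e : ℕ => x ^ (2 * e - 1))
    simpa [fac] using this
  rw [← hs2.tsum_eq, ENNReal.ofReal_tsum_of_nonneg (fun _ => by positivity) hs2.summable]
  congr 1; ext e
  rw [ENNReal.ofReal_pow h0.le]

lemma geom_all {x : ℝ} (h0 : 0 < x) (h1 : x < 1) :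
    ∑' e : ℕ, (ENNReal.ofReal x) ^ (e + 1) = ENNReal.ofReal (x / (1 - x)) := by
  have hs2 : HasSum (fun e : ℕ => x ^ (e + 1)) (x / (1 - x)) := by
    have := (hasSum_geometric_of_lt_one h0.le h1).mul_left x
    have e : (fun e : ℕ => x ^ (e + 1)) = fun i => x * x ^ i := by
      funext e
      rw [pow_succ']
    rw [div_eq_mul_inv, e]
    exact this
  rw [← hs2.tsum_eq, ENNReal.ofReal_tsum_of_nonneg (fun _ => by positivity) hs2.summable]
  congr 1; ext e
  rw [ENNReal.ofReal_pow h0.le]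

lemma SS_eq {q : ℝ} (h0 : 0 < q) (h1 : q < 1) (m : ℕ) : SS (ENNReal.ofReal q) m = ENNReal.ofReal (PP q m) := by
  induction m with
  | zero => simp [SS_zero, PP]
  | succ m ih =>
    have hx := xlt h0 h1 m
    rw [SS_succ, ih, ← ENNReal.ofReal_pow h0.le, geom_odd hx.1 hx.2, PP_succ, mul_comm,
      ENNReal.ofReal_mul (PP_pos h0 h1 m).le]

lemma pa_gf {q : ℝ} (h0 : 0 < q) (h1 : q < 1) :
    ∑' n : ℕ, (pa (n + 1) : ℝ) * q ^ (n + 1) = ∑' m, aa q m := by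
  have h := (gf_fiber (ENNReal.ofReal q)).trans (gf_total _)
  have h2 := congrArg ENNReal.toReal h
  have e1 : ∀ m, (∑' e : ℕ, (ENNReal.ofReal q ^ (m + 1)) ^ (e + 1)) * SS (ENNReal.ofReal q) m =
      ENNReal.ofReal (aa q m) := by
    intro m
    have hx := xlt h0 h1 m
    rw [← ENNReal.ofReal_pow h0.le, geom_all hx.1 hx.2, SS_eq h0 h1, aa, ENNReal.ofReal_mul]
    exact div_nonneg hx.1.le (by linarith [hx.2])
  simp_rw [e1] at h2
  rw [ENNReal.tsum_toReal_eq, ENNReal.tsum_toReal_eq] at h2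
  · have e2 : ∀ n : ℕ, ((pa (n + 1) : ℝ≥0∞) * ENNReal.ofReal q ^ (n + 1)).toReal = (pa (n + 1) : ℝ) * q ^ (n + 1) := by
      intro n
      simp [h0.le]
    have e3 : ∀ m, (ENNReal.ofReal (aa q m)).toReal = aa q m := by
      intro m
      have hx := xlt h0 h1 m
      apply ENNReal.toReal_ofReal
      exact mul_nonneg (div_nonneg hx.1.le (by linarith [hx.2])) (PP_pos h0 h1 m).le
    simp_rw [e2, e3] at h2
    exact h2
  · intro a; exact ENNReal.ofReal_ne_top
  · intro n
    exact ENNReal.mul_ne_top (by simp) (by simp)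

lemma aa_eq {q : ℝ} (h0 : 0 < q) (h1 : q < 1) (m : ℕ) :
    aa q m = (1 + q ^ (m + 1)) * (PP q (m + 1) - PP q m) := by
  have hx := xlt h0 h1 m
  rw [PP_succ, aa, fac]
  generalize q ^ (m + 1) = x at *
  have h2 : 1 - x ≠ 0 := by linarith [hx.2]
  have h3 : 1 + x ≠ 0 := by linarith [hx.1]
  have : 1 - x ^ 2 = (1 - x) * (1 + x) := by ring
  rw [this]
  field_simp
  ring

lemma PP_mono {q : ℝ} (h0 : 0 < q) (h1 : q < 1) : Monotone (PP q) := by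
  apply monotone_nat_of_le_succ
  intro m
  rw [PP_succ]
  have hx := xlt h0 h1 m
  have := fac_ge hx.1 hx.2
  nlinarith [PP_pos h0 h1 m, hx.1]

lemma PP_growth {q : ℝ} (h0 : 0 < q) (h1 : q < 1) (M k : ℕ) :
    PP q M * (q ^ (M + 1) * ∑ j ∈ Finset.range k, q ^ j) ≤ PP q (M + k) - PP q M := by
  induction k with
  | zero => simp
  | succ k ih =>
    have hx := xlt h0 h1 (M + k)
    have hf := fac_ge hx.1 hx.2
    have hm := PP_mono h0 h1 (Nat.le_add_right M k)
    rw [Finset.sum_range_succ, ← add_assoc, PP_succ]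
    have e : q ^ (M + 1) * q ^ k = q ^ (M + k + 1) := by rw [← pow_add]; congr 1; omega
    have h3 : PP q (M + k) * (1 + q ^ (M + k + 1)) ≤ PP q (M + k) * fac (q ^ (M + k + 1)) :=
      mul_le_mul_of_nonneg_left hf (PP_pos h0 h1 _).le
    have h4 : PP q M * q ^ (M + k + 1) ≤ PP q (M + k) * q ^ (M + k + 1) :=
      mul_le_mul_of_nonneg_right hm hx.1.le
    rw [mul_add, mul_add, e]
    linarith

lemma PP_key {q P : ℝ} (h0 : 0 < q) (h1 : q < 1) (hP : Tendsto (PP q) atTop (𝓝 P)) (M : ℕ) :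
    PP q M * (q ^ (M + 1) / (1 - q)) ≤ P := by
  have h2 := (hasSum_geometric_of_lt_one h0.le h1).tendsto_sum_nat
  have h3 := ((h2.const_mul (q ^ (M + 1))).const_mul (PP q M))
  have h4 : Tendsto (fun k => PP q (M + k) - PP q M) atTop (𝓝 (P - PP q M)) := by
    have : Tendsto (fun k => PP q (M + k)) atTop (𝓝 P) := by
      simp_rw [add_comm M]
      exact (tendsto_add_atTop_iff_nat M).2 hP
    exact this.sub_const _
  have := le_of_tendsto_of_tendsto' h3 h4 (PP_growth h0 h1 M)
  rw [div_eq_mul_inv]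
  linarith [PP_pos h0 h1 M]

lemma delta_hasSum {q P : ℝ} (h0 : 0 < q) (h1 : q < 1) (hP : Tendsto (PP q) atTop (𝓝 P)) :
    HasSum (fun m => PP q (m + 1) - PP q m) (P - 1) := by
  rw [hasSum_iff_tendsto_nat_of_nonneg]
  · have : ∀ n, ∑ i ∈ Finset.range n, (PP q (i + 1) - PP q i) = PP q n - 1 := by
      intro n
      rw [Finset.sum_range_sub]; simp [PP]
    simp_rw [this]
    exact hP.sub_const 1
  · intro m
    have := PP_mono h0 h1 (Nat.le_succ m)
    simpa using this

lemma aa_bounds {q P : ℝ} (h0 : 0 < q) (h1 : q < 1) (hP : Tendsto (PP q) atTop (𝓝 P)) (M : ℕ) :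
    P - 1 ≤ ∑' m, aa q m ∧ ∑' m, aa q m ≤ P + PP q M + q ^ M * P := by
  have hd := delta_hasSum h0 h1 hP
  have hd0 : ∀ m, 0 ≤ PP q (m + 1) - PP q m := fun m => by
    have := PP_mono h0 h1 (Nat.le_succ m)
    simpa using this
  have hlow : ∀ m, PP q (m + 1) - PP q m ≤ aa q m := by
    intro m
    rw [aa_eq h0 h1]
    nlinarith [hd0 m, (xlt h0 h1 m).1]
  have hup : ∀ m, aa q m ≤ (1 + q ^ M) * (PP q (m + 1) - PP q m) +
      (if m ∈ Finset.range M then PP q (m + 1) - PP q m else 0) := by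
    intro m
    rw [aa_eq h0 h1]
    split_ifs with h
    · have : 0 < q ^ M := by positivity
      nlinarith [hd0 m, (xlt h0 h1 m).2]
    · have h2 : M ≤ m := by simpa using h
      have : q ^ (m + 1) ≤ q ^ M := pow_le_pow_of_le_one h0.le h1.le (by omega)
      nlinarith [hd0 m]
  have hfin : HasSum (fun m => if m ∈ Finset.range M then PP q (m + 1) - PP q m else 0) (PP q M - 1) := by
    have : ∑ i ∈ Finset.range M, (PP q (i + 1) - PP q i) = PP q M - 1 := by
      rw [Finset.sum_range_sub]; simp [PP]
    rw [← this]
    have h3 : HasSum (fun m => if m ∈ Finset.range M then PP q (m + 1) - PP q m else 0)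
        (∑ m ∈ Finset.range M, if m ∈ Finset.range M then PP q (m + 1) - PP q m else 0) :=
      hasSum_sum_of_ne_finset_zero (fun b hb => by simp only [hb, if_false])
    rw [Finset.sum_congr rfl (fun x hx => if_pos hx)] at h3
    exact h3
  have hU := (hd.mul_left (1 + q ^ M)).add hfin
  have hs : Summable (aa q) := Summable.of_nonneg_of_le (fun m => (hd0 m).trans (hlow m)) hup hU.summable
  constructor
  · exact hasSum_le hlow hd hs.hasSum
  · have := hasSum_le hup hs.hasSum hU
    have h5 : 0 < q ^ M := by positivity
    nlinarith

noncomputable def Pinf (ε : ℝ) : ℝ :=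
  (∏' n : ℕ, (1 - Real.exp (-(2 * ε)) ^ (n + 1)))⁻¹ * Real.exp (∑' i : ℕ, gg ((i + 1 : ℕ) * ε))

lemma PP_tendsto (ε : ℝ) (hε : 0 < ε) : Tendsto (PP (Real.exp (-ε))) atTop (𝓝 (Pinf ε)) := by
  have hq1 : Real.exp (-(2 * ε)) < 1 := by
    rw [Real.exp_lt_one_iff]; linarith
  have hsum : Summable fun n : ℕ => -Real.exp (-(2 * ε)) ^ (n + 1) :=
    ((summable_nat_add_iff 1).2 (summable_geometric_of_lt_one (Real.exp_pos _).le hq1)).neg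
  have hne' : ∀ n : ℕ, 1 - Real.exp (-(2 * ε)) ^ (n + 1) ≠ 0 := fun n => by
    have := (xlt (Real.exp_pos _) hq1 n).2
    linarith
  have hmul : Multipliable fun n : ℕ => (1 - Real.exp (-(2 * ε)) ^ (n + 1)) := by
    simp_rw [sub_eq_add_neg]
    exact Real.multipliable_one_add_of_summable hsum
  have hne : (∏' n : ℕ, (1 - Real.exp (-(2 * ε)) ^ (n + 1))) ≠ 0 := by
    simp_rw [sub_eq_add_neg] at hne' ⊢
    exact tprod_one_add_ne_zero_of_summable hne' hsum.norm
  have h1 := hmul.hasProd.tendsto_prod_nat.inv₀ hne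
  have h2 := (Real.continuous_exp.tendsto _).comp (gg_summable ε hε).hasSum.tendsto_sum_nat
  refine (h1.mul h2).congr fun m => ?_
  simp only [Function.comp]
  rw [Real.exp_sum, ← Finset.prod_inv_distrib, ← Finset.prod_mul_distrib, PP]
  apply Finset.prod_congr rfl
  intro i _
  have hi : 0 ≤ ((i + 1 : ℕ) : ℝ) * ε := by positivity
  have e1 : Real.exp (-ε) ^ (i + 1) = Real.exp (-(((i + 1 : ℕ) : ℝ) * ε)) := by
    rw [← Real.exp_nat_mul]; congr 1; ring
  have e2 : Real.exp (-(2 * ε)) ^ (i + 1) = Real.exp (-(((i + 1 : ℕ) : ℝ) * ε)) ^ 2 := by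
    rw [← Real.exp_nat_mul, ← Real.exp_nat_mul]; congr 1; push_cast; ring
  have h3 := hne' i
  rw [gg, Real.exp_log (lt_of_lt_of_le one_pos (uge hi)), e1, fac]
  rw [e2] at h3 ⊢
  field_simp
  ring

lemma choose_M (ε : ℝ) (hε : 0 < ε) (hε1 : ε < 1) :
    ∃ M : ℕ, Real.exp (-ε) ^ M ≤ Real.sqrt ε ∧ Real.sqrt ε * Real.exp (-(2 * ε)) ≤ Real.exp (-ε) ^ (M + 1) := by
  have hs : Real.sqrt ε = Real.exp (Real.log ε / 2) := by
    rw [Real.sqrt_eq_rpow, Real.rpow_def_of_pos hε]; congr 1; ring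
  have hl : Real.log ε < 0 := Real.log_neg hε hε1
  have hpos : 0 ≤ -Real.log ε / 2 / ε := by
    apply div_nonneg _ hε.le; linarith
  refine ⟨⌈-Real.log ε / 2 / ε⌉₊, ?_, ?_⟩
  · rw [hs, ← Real.exp_nat_mul, Real.exp_le_exp]
    have := Nat.le_ceil (-Real.log ε / 2 / ε)
    rw [div_le_iff₀ hε] at this
    linarith
  · rw [hs, ← Real.exp_nat_mul, ← Real.exp_add, Real.exp_le_exp]
    have := (Nat.ceil_lt_add_one hpos).le
    have h2 := mul_le_mul_of_nonneg_right this hε.le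
    rw [add_mul, div_mul_cancel₀ _ hε.ne'] at h2
    push_cast
    linarith

lemma ratio_bounds (ε : ℝ) (hε : 0 < ε) (hε1 : ε < 1) :
    1 - ε * Real.exp ε ≤ (∑' n : ℕ, (pa (n + 1) : ℝ) * Real.exp (-ε) ^ (n + 1)) / Pinf ε ∧
    (∑' n : ℕ, (pa (n + 1) : ℝ) * Real.exp (-ε) ^ (n + 1)) / Pinf ε ≤
      1 + Real.sqrt ε * Real.exp (2 * ε) + Real.sqrt ε := by
  have h0 := Real.exp_pos (-ε)
  have h1 : Real.exp (-ε) < 1 := by rw [Real.exp_lt_one_iff]; linarith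
  have hP := PP_tendsto ε hε
  have hq : 1 - Real.exp (-ε) ≤ ε := by linarith [Real.add_one_le_exp (-ε)]
  have hq0 : 0 < 1 - Real.exp (-ε) := by linarith
  rw [pa_gf h0 h1]
  have hk0 := PP_key h0 h1 hP 0
  have hPP0 : PP (Real.exp (-ε)) 0 = 1 := by simp [PP]
  rw [hPP0, one_mul, zero_add, pow_one] at hk0
  have hPpos : 0 < Pinf ε := lt_of_lt_of_le (by positivity) hk0
  obtain ⟨M, hM1, hM2⟩ := choose_M ε hε hε1
  obtain ⟨hlo, hup⟩ := aa_bounds h0 h1 hP M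
  have hk := PP_key h0 h1 hP M
  have hs : 0 < Real.sqrt ε := Real.sqrt_pos.2 hε
  have hss : Real.sqrt ε * Real.sqrt ε = ε := Real.mul_self_sqrt hε.le
  constructor
  · rw [le_div_iff₀ hPpos]
    rw [div_le_iff₀ hq0] at hk0
    have e : Real.exp ε * Real.exp (-ε) = 1 := by rw [← Real.exp_add]; simp
    have h5 : Real.exp (-ε) ≤ Pinf ε * ε := hk0.trans (mul_le_mul_of_nonneg_left hq hPpos.le)
    have h6 := mul_le_mul_of_nonneg_left h5 (Real.exp_pos ε).le
    rw [e] at h6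
    linarith
  · rw [div_le_iff₀ hPpos]
    rw [← mul_div_assoc, div_le_iff₀ hq0] at hk
    have hPM := PP_pos h0 h1 M
    have h5 : PP (Real.exp (-ε)) M * (Real.sqrt ε * Real.exp (-(2 * ε))) ≤ Pinf ε * ε :=
      (mul_le_mul_of_nonneg_left hM2 hPM.le).trans (hk.trans (mul_le_mul_of_nonneg_left hq hPpos.le))
    have e : Real.exp (2 * ε) * Real.exp (-(2 * ε)) = 1 := by rw [← Real.exp_add]; simp
    have h6 : PP (Real.exp (-ε)) M ≤ Real.sqrt ε * Real.exp (2 * ε) * Pinf ε := by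
      have h7 : PP (Real.exp (-ε)) M * Real.exp (-(2 * ε)) ≤ Pinf ε * Real.sqrt ε := by
        refine le_of_mul_le_mul_right ?_ hs
        rw [mul_assoc (Pinf ε), hss]
        linarith
      have h8 := mul_le_mul_of_nonneg_left h7 (Real.exp_pos (2 * ε)).le
      calc PP (Real.exp (-ε)) M = (Real.exp (2 * ε) * Real.exp (-(2 * ε))) * PP (Real.exp (-ε)) M := by rw [e, one_mul]
        _ = Real.exp (2 * ε) * (PP (Real.exp (-ε)) M * Real.exp (-(2 * ε))) := by ring
        _ ≤ _ := h8
        _ = _ := by ring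
    have h9 := mul_le_mul_of_nonneg_right hM1 hPpos.le
    linarith

lemma ratio_tendsto : Tendsto (fun ε : ℝ => (∑' n : ℕ, (pa (n + 1) : ℝ) * Real.exp (-ε) ^ (n + 1)) / Pinf ε)
    (𝓝[>] 0) (𝓝 1) := by
  have hev : ∀ᶠ ε : ℝ in 𝓝[>] 0, 0 < ε ∧ ε < 1 := Ioo_mem_nhdsGT one_pos
  have c1 : Tendsto (fun ε : ℝ => 1 - ε * Real.exp ε) (𝓝[>] 0) (𝓝 1) := by
    have : Continuous (fun ε : ℝ => 1 - ε * Real.exp ε) := by fun_prop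
    simpa using (this.tendsto 0).mono_left nhdsWithin_le_nhds
  have c2 : Tendsto (fun ε : ℝ => 1 + Real.sqrt ε * Real.exp (2 * ε) + Real.sqrt ε) (𝓝[>] 0) (𝓝 1) := by
    have : Continuous (fun ε : ℝ => 1 + Real.sqrt ε * Real.exp (2 * ε) + Real.sqrt ε) := by fun_prop
    simpa using (this.tendsto 0).mono_left nhdsWithin_le_nhds
  exact tendsto_of_tendsto_of_tendsto_of_le_of_le' c1 c2
    (hev.mono fun ε h => (ratio_bounds ε h.1 h.2).1) (hev.mono fun ε h => (ratio_bounds ε h.1 h.2).2)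

lemma exp_tendsto : Tendsto (fun ε : ℝ => Real.exp ((∑' i : ℕ, gg ((i + 1 : ℕ) * ε)) - 2 * uu0 ^ 2 / ε))
    (𝓝[>] 0) (𝓝 1) := by
  have h : Tendsto (fun ε : ℝ => (∑' i : ℕ, gg ((i + 1 : ℕ) * ε)) - 2 * uu0 ^ 2 / ε) (𝓝[>] 0) (𝓝 0) := by
    apply squeeze_zero_norm' (a := fun ε => 5 * ε * Real.exp ε)
    · filter_upwards [self_mem_nhdsWithin] with ε hε
      exact gg_bound _ gg_integral ε hε
    · have : Continuous (fun ε : ℝ => 5 * ε * Real.exp ε) := by fun_prop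
      simpa using (this.tendsto 0).mono_left nhdsWithin_le_nhds
  have h2 := (Real.continuous_exp.tendsto 0).comp h
  rw [Real.exp_zero] at h2
  exact h2

theorem pa_gf_asymptotic (A : ℝ)
    (hA : A = Real.pi ^ 2 / 12 + 2 * Real.log ((1 + Real.sqrt 5) / 2) ^ 2) :
    Tendsto (fun ε : ℝ =>
        (∑' n : ℕ, (pa (n + 1) : ℝ) * Real.exp (-ε) ^ (n + 1)) /
          (Real.sqrt (ε / Real.pi) * Real.exp (A / ε)))
      (𝓝[>] 0) (𝓝 1) := by
  have h := (ratio_tendsto.mul euler_asymp).mul exp_tendsto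
  simp only [mul_one] at h
  refine h.congr' ?_
  filter_upwards [Ioo_mem_nhdsGT (one_pos : (0:ℝ) < 1)] with ε hε
  have hε : 0 < ε := hε.1
  have hPpos : Pinf ε ≠ 0 := by
    have := PP_mono (Real.exp_pos (-ε)) (by rw [Real.exp_lt_one_iff]; linarith)
    have h1 := this.ge_of_tendsto (PP_tendsto ε hε) 0
    have h2 : PP (Real.exp (-ε)) 0 = 1 := by simp [PP]
    linarith
  have e1 : Real.exp (A / ε) = Real.exp (Real.pi ^ 2 / 12 / ε) * Real.exp (2 * uu0 ^ 2 / ε) := by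
    rw [← Real.exp_add, hA, uu0]; congr 1; ring
  have hs : 0 < Real.sqrt (ε / Real.pi) := Real.sqrt_pos.mpr (div_pos hε Real.pi_pos)
  rw [e1, Real.exp_sub]
  have hPd : Pinf ε = (∏' n : ℕ, (1 - Real.exp (-(2 * ε)) ^ (n + 1)))⁻¹ *
    Real.exp (∑' i : ℕ, gg ((i + 1 : ℕ) * ε)) := rfl
  rw [hPd] at hPpos ⊢
  generalize (∏' n : ℕ, (1 - Real.exp (-(2 * ε)) ^ (n + 1))) = D at *
  have hD : D ≠ 0 := by
    rintro rfl
    simp at hPpos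
  field_simp
end

section
/- As ε → 0^+, the infinite product (e^{−ε}; e^{−ε})_∞ = ∏_{k≥1} (1 − e^{−kε}) is asymptotically equal to √(2π/ε)·e^{−π²/(6ε)}; that is, the ratio of the two sides tends to 1 as ε → 0^+. -/
open Filter Topology

/-- The q-Pochhammer symbol at `q = exp (-ε)`. -/
noncomputable def etaP (ε : ℝ) : ℝ := ∏' k : ℕ, (1 - Real.exp (-(k + 1 : ℕ) * ε))

lemma etaP_tendsto : Tendsto etaP atTop (𝓝 1) := by
  have := tendsto_tprod_one_add_of_dominated_convergence (𝓕 := (atTop : Filter ℝ))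
    (g := (0 : ℕ → ℝ)) (f := fun (x : ℝ) (n : ℕ) ↦ -Real.exp (-(n + 1 : ℕ) * x))
    (bound := fun n ↦ Real.exp (-1) ^ (n + 1))
  simp only [Pi.zero_apply, norm_neg, add_zero, tprod_one, ← sub_eq_add_neg] at this
  refine this ?_ ?_ ?_
  · exact (summable_nat_add_iff 1).2
      (summable_geometric_of_lt_one (Real.exp_pos _).le (by simp))
  · intro k
    rw [← neg_zero]
    refine Tendsto.neg (Real.tendsto_exp_atBot.comp ?_)
    exact tendsto_id.const_mul_atTop_of_neg (by
      have : (0 : ℝ) < ((k + 1 : ℕ) : ℝ) := by positivity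
      linarith)
  · filter_upwards [eventually_ge_atTop 1] with x hx k
    rw [Real.norm_of_nonneg (Real.exp_pos _).le, ← Real.exp_nat_mul]
    apply Real.exp_le_exp.2
    have : (0 : ℝ) < ((k + 1 : ℕ) : ℝ) := by positivity
    nlinarith

lemma eta_I_mul (t : ℝ) :
    ModularForm.eta (Complex.I * t) =
      ((Real.exp (-(Real.pi * t / 12)) * etaP (2 * Real.pi * t) : ℝ) : ℂ) := by
  unfold ModularForm.eta etaP
  rw [Complex.ofReal_mul]
  congr 1
  · rw [Function.Periodic.qParam, Complex.ofReal_exp]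
    congr 1
    push_cast
    linear_combination (Real.pi * t / 12 : ℂ) * Complex.I_sq
  · rw [show ((∏' k : ℕ, (1 - Real.exp (-(k + 1 : ℕ) * (2 * Real.pi * t))) : ℝ) : ℂ) =
      ∏' k : ℕ, ((1 - Real.exp (-(k + 1 : ℕ) * (2 * Real.pi * t)) : ℝ) : ℂ) from
        Function.LeftInverse.map_tprod (g := Complex.ofRealHom) _
          Complex.continuous_ofReal Complex.continuous_re (fun x ↦ Complex.ofReal_re x)]
    refine tprod_congr fun n ↦ ?_
    rw [ModularForm.eta_q_eq_cexp, Complex.ofReal_sub, Complex.ofReal_one, Complex.ofReal_exp]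
    congr 2
    push_cast
    linear_combination (2 * Real.pi * (n + 1) * t : ℂ) * Complex.I_sq

lemma sqrt_I_mul {t : ℝ} (ht : 0 < t) :
    Complex.sqrt (Complex.I * t) = Complex.sqrt Complex.I * (Real.sqrt t : ℝ) := by
  have ht' : (t : ℂ) ≠ 0 := by exact_mod_cast ht.ne'
  rw [_root_.sqrt_eq_exp (mul_ne_zero Complex.I_ne_zero ht'),
    _root_.sqrt_eq_exp Complex.I_ne_zero, mul_comm Complex.I,
    Complex.log_ofReal_mul ht Complex.I_ne_zero, Real.sqrt_eq_rpow,
    Real.rpow_def_of_pos ht, Complex.ofReal_exp, ← Complex.exp_add]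
  congr 1
  push_cast
  ring

lemma etaP_transform {t : ℝ} (ht : 0 < t) :
    Real.exp (-(Real.pi * t⁻¹ / 12)) * etaP (2 * Real.pi * t⁻¹) =
      Real.sqrt t * (Real.exp (-(Real.pi * t / 12)) * etaP (2 * Real.pi * t)) := by
  have ht' : (t : ℂ) ≠ 0 := by exact_mod_cast ht.ne'
  have h := ModularForm.eta_comp_eq_csqrt_I_inv
    (show Complex.I * (t : ℂ) ∈ UpperHalfPlane.upperHalfPlaneSet by
      simpa [UpperHalfPlane.upperHalfPlaneSet] using ht)
  simp only [Function.comp_apply, Pi.smul_apply, Pi.mul_apply, smul_eq_mul] at h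
  rw [show -1 / (Complex.I * (t : ℂ)) = Complex.I * ((t⁻¹ : ℝ) : ℂ) by
    push_cast
    field_simp
    simp, sqrt_I_mul ht, eta_I_mul, eta_I_mul] at h
  have h0 : Complex.sqrt Complex.I ≠ 0 := by
    rw [_root_.sqrt_eq_exp Complex.I_ne_zero]; exact Complex.exp_ne_zero _
  rw [mul_assoc (Complex.sqrt Complex.I), inv_mul_cancel_left₀ h0] at h
  exact_mod_cast h

theorem eta_product_asymptotic :
    Tendsto (fun ε : ℝ =>
        (∏' k : ℕ, (1 - Real.exp (-(k + 1 : ℕ) * ε))) /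
          (Real.sqrt (2 * Real.pi / ε) * Real.exp (-Real.pi ^ 2 / (6 * ε))))
      (𝓝[>] 0) (𝓝 1) := by
  have hpi := Real.pi_pos
  have h1 : Tendsto (fun ε : ℝ => Real.exp (ε / 24) * etaP (4 * Real.pi ^ 2 * ε⁻¹))
      (𝓝[>] 0) (𝓝 1) := by
    rw [← mul_one (1 : ℝ)]
    refine Tendsto.mul ?_ (etaP_tendsto.comp
      (tendsto_inv_nhdsGT_zero.const_mul_atTop (by positivity)))
    have : Continuous fun ε : ℝ => Real.exp (ε / 24) := by fun_prop
    simpa using (this.tendsto 0).mono_left nhdsWithin_le_nhds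
  refine h1.congr' ?_
  filter_upwards [self_mem_nhdsWithin] with ε hε
  have hε : 0 < ε := hε
  change _ = etaP ε / _
  have h := etaP_transform (t := (2 * Real.pi / ε)) (by positivity)
  rw [show 2 * Real.pi * (2 * Real.pi / ε)⁻¹ = ε by field_simp,
    show 2 * Real.pi * (2 * Real.pi / ε) = 4 * Real.pi ^ 2 * ε⁻¹ by field_simp; ring,
    show -(Real.pi * (2 * Real.pi / ε)⁻¹ / 12) = -(ε / 24) by field_simp; ring,
    show -(Real.pi * (2 * Real.pi / ε) / 12) = -Real.pi ^ 2 / (6 * ε) by field_simp; ring,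
    Real.exp_neg] at h
  rw [eq_div_iff (by positivity)]
  have h2 : etaP ε = Real.exp (ε / 24) * ((Real.exp (ε / 24))⁻¹ * etaP ε) := by
    field_simp
  rw [h2, h]
  ring
end

section
/- For |q| < 1, the generating function identity 1 + ∑_{n≥1} pa_o(n) q^n = ∏_{k≥1} (1 + q^k − q^{2k})/(1 − q^{2k}) holds. -/
/-- The smallest part of the partition is odd. -/
def SmallestPartOdd {n : ℕ} (p : n.Partition) : Prop :=
  ∃ a ∈ p.parts, Odd a ∧ ∀ b ∈ p.parts, a ≤ b

/-- The number of unlimited parity alternating partitions of `n` whose smallest part is odd. -/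
noncomputable def paOdd (n : ℕ) : ℕ :=
  Nat.card {p : n.Partition // ParityAlternating p ∧ SmallestPartOdd p}

namespace PAConj
open YoungDiagram

theorem rowLens_sum (μ : YoungDiagram) : μ.rowLens.sum = μ.card := by
  have h : μ.card = ∑ i ∈ Finset.range (μ.colLen 0), (μ.row i).card := by
    refine Finset.card_eq_sum_card_fiberwise (f := Prod.fst) ?_
    rintro ⟨i, j⟩ hc
    have hc : (i, j) ∈ μ := hc
    simp only [Finset.coe_range, Set.mem_Iio]
    rw [← mem_iff_lt_colLen]
    exact μ.up_left_mem le_rfl (Nat.zero_le _) hc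
  rw [h, rowLens, ← List.sum_toFinset _ List.nodup_range]
  simp only [rowLen_eq_card, List.toFinset_range]

/-- partition of a Young diagram -/
def toPart {n : ℕ} (μ : {μ : YoungDiagram // μ.card = n}) : n.Partition where
  parts := (μ.1.rowLens : Multiset ℕ)
  parts_pos := fun {i} hi => μ.1.pos_of_mem_rowLens i (by simpa using hi)
  parts_sum := by rw [Multiset.sum_coe, rowLens_sum, μ.2]

theorem toPart_bij (n : ℕ) : Function.Bijective (toPart (n := n)) := by
  constructor
  · rintro ⟨μ, hμ⟩ ⟨ν, hν⟩ h
    have h : (μ.rowLens : Multiset ℕ) = ν.rowLens := congrArg Nat.Partition.parts h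
    have h2 : μ.rowLens = ν.rowLens :=
      (Multiset.coe_eq_coe.1 h).eq_of_pairwise' μ.rowLens_sorted.pairwise ν.rowLens_sorted.pairwise
    have : μ = ν := by
      apply equivListRowLens.injective
      exact Subtype.ext h2
    exact Subtype.ext this
  · intro p
    have hs : (p.parts.sort (· ≥ ·)).SortedGE := (Multiset.pairwise_sort _ _).sortedGE
    have hpos : ∀ x ∈ p.parts.sort (· ≥ ·), 0 < x := fun x hx =>
      p.parts_pos (by simpa using hx)
    have h1 := rowLens_ofRowLens_eq_self (hw := hs) hpos
    refine ⟨⟨ofRowLens _ hs, ?_⟩, ?_⟩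
    · rw [← rowLens_sum, h1, ← Multiset.sum_coe, Multiset.sort_eq, p.parts_sum]
    · apply Nat.Partition.ext
      simp only [toPart]
      rw [h1, Multiset.sort_eq]

theorem card_transpose (μ : YoungDiagram) : μ.transpose.card = μ.card := by
  simp [YoungDiagram.card, transpose]

def tr (n : ℕ) : {μ : YoungDiagram // μ.card = n} ≃ {μ : YoungDiagram // μ.card = n} where
  toFun μ := ⟨μ.1.transpose, by rw [card_transpose, μ.2]⟩
  invFun μ := ⟨μ.1.transpose, by rw [card_transpose, μ.2]⟩
  left_inv μ := by simp
  right_inv μ := by simp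

def Good (μ : YoungDiagram) : Prop :=
  ∀ i, μ.rowLen i = μ.rowLen (i + 1) ∨ Odd (μ.rowLen i - μ.rowLen (i + 1))

theorem count_transpose (μ : YoungDiagram) (c : ℕ) :
    μ.transpose.rowLens.count (c + 1) = μ.rowLen c - μ.rowLen (c + 1) := by
  rw [← Nat.card_Ico, ← Multiset.coe_count, rowLens, colLen_transpose, ← Multiset.map_coe,
    Multiset.count_map]
  have : Finset.Ico (μ.rowLen (c + 1)) (μ.rowLen c) =
      (Finset.range (μ.rowLen 0)).filter fun a => c + 1 = μ.transpose.rowLen a := by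
    ext j
    simp only [Finset.mem_Ico, Finset.mem_filter, Finset.mem_range, rowLen_transpose]
    have h1 := mem_iff_lt_rowLen (μ := μ) (i := c) (j := j)
    have h2 := mem_iff_lt_rowLen (μ := μ) (i := c + 1) (j := j)
    rw [mem_iff_lt_colLen] at h1 h2
    have h3 := μ.rowLen_anti 0 c (Nat.zero_le _)
    omega
  rw [this]
  rfl

theorem good_iff_odd (μ : YoungDiagram) :
    Good μ ↔ ∀ i ∈ (μ.transpose.rowLens : Multiset ℕ),
      Odd ((μ.transpose.rowLens : Multiset ℕ).count i) := by
  constructor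
  · intro h i hi
    obtain ⟨c, rfl⟩ : ∃ c, i = c + 1 :=
      ⟨i - 1, by have := μ.transpose.pos_of_mem_rowLens i (by simpa using hi); omega⟩
    have h0 := Multiset.count_pos.2 hi
    rw [Multiset.coe_count, count_transpose] at h0 ⊢
    rcases h c with h | h
    · omega
    · exact h
  · intro h i
    by_cases hi : i + 1 ∈ (μ.transpose.rowLens : Multiset ℕ)
    · have := h _ hi
      rw [Multiset.coe_count, count_transpose] at this
      exact Or.inr this
    · have := Multiset.count_eq_zero.2 hi
      rw [Multiset.coe_count, count_transpose] at this
      have h3 := μ.rowLen_anti i (i + 1) (by omega)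
      left; omega

theorem mem_parts {n : ℕ} (μ : {μ : YoungDiagram // μ.card = n}) (x : ℕ) :
    x ∈ (toPart μ).parts ↔ 0 < x ∧ ∃ i, μ.1.rowLen i = x := by
  constructor
  · intro h
    refine ⟨(toPart μ).parts_pos h, ?_⟩
    simp only [toPart, Multiset.mem_coe, rowLens, List.mem_map] at h
    obtain ⟨i, -, h⟩ := h
    exact ⟨i, h⟩
  · rintro ⟨h0, i, rfl⟩
    simp only [toPart, Multiset.mem_coe, rowLens, List.mem_map, List.mem_range]
    exact ⟨i, by rwa [← mem_iff_lt_colLen, mem_iff_lt_rowLen], rfl⟩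

theorem exists_zero (μ : YoungDiagram) : ∃ i, μ.rowLen i = 0 := by
  refine ⟨μ.colLen 0, ?_⟩
  have h := mem_iff_lt_rowLen (μ := μ) (i := μ.colLen 0) (j := 0)
  rw [mem_iff_lt_colLen] at h
  omega

/-- last index where the row length is at least `b`. -/
theorem exists_last (μ : YoungDiagram) (b : ℕ) (hb : 0 < b) (l : ℕ) (hl : b ≤ μ.rowLen l) :
    ∃ i, l ≤ i ∧ b ≤ μ.rowLen i ∧ μ.rowLen (i + 1) < b := by
  by_contra! h
  have : ∀ k, b ≤ μ.rowLen (l + k) := by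
    intro k
    induction k with
    | zero => exact hl
    | succ k ih => exact h (l + k) (Nat.le_add_right _ _) ih
  obtain ⟨z, hz⟩ := exists_zero μ
  have h1 := this z
  have h2 := μ.rowLen_anti z (l + z) (by omega)
  omega

theorem good_iff_pa {n : ℕ} (hn : 0 < n) (μ : {μ : YoungDiagram // μ.card = n}) :
    (ParityAlternating (toPart μ) ∧ SmallestPartOdd (toPart μ)) ↔ Good μ.1 := by
  simp only [ParityAlternating, SmallestPartOdd, mem_parts]
  constructor
  · rintro ⟨h1, a0, ⟨ha0, i0, rfl⟩, hodd, hmin⟩ i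
    have hanti := μ.1.rowLen_anti i (i + 1) (by omega)
    rcases hanti.eq_or_lt with h | hlt
    · exact Or.inl h.symm
    right
    rcases Nat.eq_zero_or_pos (μ.1.rowLen (i + 1)) with hz | hpos
    · have h2 := hmin (μ.1.rowLen i) ⟨by omega, i, rfl⟩
      have h3 : i0 ≤ i := by
        by_contra! h
        have := μ.1.rowLen_anti (i + 1) i0 h
        omega
      have h4 := μ.1.rowLen_anti i0 i h3
      rw [hz, Nat.sub_zero, le_antisymm h4 h2]
      exact hodd
    · have := h1 (μ.1.rowLen (i + 1)) ⟨hpos, _, rfl⟩ (μ.1.rowLen i) ⟨by omega, _, rfl⟩ hlt (by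
        rintro c ⟨-, k, rfl⟩ ⟨h2, h3⟩
        rcases le_or_gt k i with hk | hk
        · have := μ.1.rowLen_anti k i hk
          omega
        · have := μ.1.rowLen_anti (i + 1) k hk
          omega)
      rw [Nat.odd_sub hanti]
      grind
  · intro h
    constructor
    · rintro a ⟨ha, k, rfl⟩ b ⟨hb, l, rfl⟩ hab hc
      obtain ⟨i, hli, hi1, hi2⟩ := exists_last μ.1 _ hb l le_rfl
      have h1 := μ.1.rowLen_anti l i hli
      have h2 : i + 1 ≤ k := by
        by_contra! h
        have := μ.1.rowLen_anti k i (by omega)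
        omega
      have h3 := μ.1.rowLen_anti (i + 1) k h2
      have h4 : μ.1.rowLen (i + 1) = μ.1.rowLen k := by
        by_contra hne
        exact hc (μ.1.rowLen (i + 1)) ⟨by omega, _, rfl⟩ ⟨by omega, hi2⟩
      have h5 := h i
      rw [h4, le_antisymm h1 hi1] at h5
      rcases h5 with h5 | h5
      · omega
      · rw [Nat.odd_sub hab.le] at h5
        grind
    · have h0 : 1 ≤ μ.1.rowLen 0 := by
        have hc : μ.1.cells.Nonempty := by
          rw [← Finset.card_pos]
          have := μ.2
          unfold YoungDiagram.card at this
          omega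
        obtain ⟨⟨i, j⟩, hij⟩ := hc
        have hij : (i, j) ∈ μ.1 := hij
        have := μ.1.up_left_mem (Nat.zero_le i) (Nat.zero_le j) hij
        rw [mem_iff_lt_rowLen] at this
        omega
      obtain ⟨i, -, hi1, hi2⟩ := exists_last μ.1 1 one_pos 0 h0
      refine ⟨μ.1.rowLen i, ⟨hi1, i, rfl⟩, ?_, ?_⟩
      · have hz : μ.1.rowLen (i + 1) = 0 := by omega
        have := h i
        rw [hz, Nat.sub_zero] at this
        rcases this with h | h
        · omega
        · exact h
      · rintro b ⟨hb, k, rfl⟩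
        refine μ.1.rowLen_anti k i ?_
        by_contra! hk
        have := μ.1.rowLen_anti (i + 1) k hk
        omega

theorem paOdd_eq {n : ℕ} (hn : 0 < n) :
    paOdd n = Nat.card {p : n.Partition // ∀ i ∈ p.parts, Odd (p.parts.count i)} := by
  let e := Equiv.ofBijective _ (toPart_bij n)
  refine Nat.card_congr ?_
  refine (e.subtypeEquiv (p := fun μ => Good μ.1) fun μ => (good_iff_pa hn μ).symm).symm.trans ?_
  exact ((tr n).trans e).subtypeEquiv fun μ => good_iff_odd μ.1

end PAConj

open Finset in
theorem pa_mul_hasSum {A B : PowerSeries ℝ} {q a b : ℂ}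
    (hA : Summable fun n => ‖((PowerSeries.coeff n A : ℝ) : ℂ) * q ^ n‖)
    (hA' : HasSum (fun n => ((PowerSeries.coeff n A : ℝ) : ℂ) * q ^ n) a)
    (hB : Summable fun n => ‖((PowerSeries.coeff n B : ℝ) : ℂ) * q ^ n‖)
    (hB' : HasSum (fun n => ((PowerSeries.coeff n B : ℝ) : ℂ) * q ^ n) b) :
    (Summable fun n => ‖((PowerSeries.coeff n (A * B) : ℝ) : ℂ) * q ^ n‖) ∧
    HasSum (fun n => ((PowerSeries.coeff n (A * B) : ℝ) : ℂ) * q ^ n) (a * b) := by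
  have key : ∀ n, ((PowerSeries.coeff n (A * B) : ℝ) : ℂ) * q ^ n =
      ∑ kl ∈ antidiagonal n, (((PowerSeries.coeff kl.1 A : ℝ) : ℂ) * q ^ kl.1) *
        (((PowerSeries.coeff kl.2 B : ℝ) : ℂ) * q ^ kl.2) := by
    intro n
    rw [PowerSeries.coeff_mul]
    push_cast
    rw [Finset.sum_mul]
    refine Finset.sum_congr rfl fun x hx => ?_
    rw [← mem_antidiagonal.1 hx, pow_add]
    ring
  have hs := summable_norm_sum_mul_antidiagonal_of_summable_norm hA hB
  simp_rw [key]
  refine ⟨hs, ?_⟩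
  rw [← hA'.tsum_eq, ← hB'.tsum_eq, tsum_mul_tsum_eq_tsum_sum_antidiagonal_of_summable_norm hA hB]
  exact hs.of_norm.hasSum

open Filter Topology in
theorem pa_analytic (P : ℕ → PowerSeries ℝ) (A : PowerSeries ℝ) (u : ℕ → ℂ → ℂ)
    (hP : ∀ i n, 0 ≤ PowerSeries.coeff n (P i)) (hP0 : ∀ i, PowerSeries.coeff 0 (P i) = 1)
    (hlim : ∀ n, Tendsto (fun N => PowerSeries.coeff n (∏ i ∈ Finset.range N, P i)) atTop
      (𝓝 (PowerSeries.coeff n A)))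
    (hsum : ∀ i (q : ℂ), ‖q‖ < 1 →
      HasSum (fun n => ((PowerSeries.coeff n (P i) : ℝ) : ℂ) * q ^ n) (1 + u i q))
    (hu : ∀ q : ℂ, ‖q‖ < 1 → Summable fun i => ‖u i q‖)
    (q : ℂ) (hq : ‖q‖ < 1) :
    HasSum (fun n => ((PowerSeries.coeff n A : ℝ) : ℂ) * q ^ n) (∏' i, (1 + u i q)) := by
  have hr : ∀ n (C : PowerSeries ℝ) (q : ℂ), 0 ≤ PowerSeries.coeff n C →
      ‖((PowerSeries.coeff n C : ℝ) : ℂ) * q ^ n‖ = PowerSeries.coeff n C * ‖q‖ ^ n := by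
    intro n C q h
    rw [norm_mul, norm_pow, Complex.norm_real, Real.norm_of_nonneg h]
  set Q : ℕ → PowerSeries ℝ := fun N => ∏ i ∈ Finset.range N, P i with hQ
  have hQs : ∀ N, Q (N + 1) = Q N * P N := fun N => Finset.prod_range_succ _ _
  have hQ0 : ∀ N n, 0 ≤ PowerSeries.coeff n (Q N) := by
    intro N
    induction N with
    | zero => intro n; simp only [hQ, Finset.range_zero, Finset.prod_empty, PowerSeries.coeff_one]
              split_ifs <;> simp
    | succ N ih =>
      intro n
      rw [hQs, PowerSeries.coeff_mul]
      exact Finset.sum_nonneg fun x _ => mul_nonneg (ih _) (hP _ _)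
  have hmono : ∀ n, Monotone fun N => PowerSeries.coeff n (Q N) := by
    intro n
    refine monotone_nat_of_le_succ fun N => ?_
    rw [hQs, PowerSeries.coeff_mul]
    have := Finset.single_le_sum (s := Finset.HasAntidiagonal.antidiagonal n)
      (f := fun x => PowerSeries.coeff x.1 (Q N) * PowerSeries.coeff x.2 (P N))
      (fun x _ => mul_nonneg (hQ0 _ _) (hP _ _)) (a := (n, 0)) (by simp)
    simpa [hP0] using this
  have hle : ∀ N n, PowerSeries.coeff n (Q N) ≤ PowerSeries.coeff n A :=
    fun N n => (hmono n).ge_of_tendsto (hlim n) N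
  have hA0 : ∀ n, 0 ≤ PowerSeries.coeff n A := fun n => (hQ0 0 n).trans (hle 0 n)
  have hns : ∀ (q : ℂ), ‖q‖ < 1 → ∀ i,
      Summable fun n => ‖((PowerSeries.coeff n (P i) : ℝ) : ℂ) * q ^ n‖ :=
    fun q hq i => (hsum i q hq).summable.norm
  have hQsum : ∀ (q : ℂ), ‖q‖ < 1 → ∀ N,
      (Summable fun n => ‖((PowerSeries.coeff n (Q N) : ℝ) : ℂ) * q ^ n‖) ∧
      HasSum (fun n => ((PowerSeries.coeff n (Q N) : ℝ) : ℂ) * q ^ n)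
        (∏ i ∈ Finset.range N, (1 + u i q)) := by
    intro q hq N
    induction N with
    | zero =>
      have : HasSum (fun n => ((PowerSeries.coeff n (Q 0) : ℝ) : ℂ) * q ^ n) 1 := by
        convert hasSum_single (f := fun n => ((PowerSeries.coeff n (Q 0) : ℝ) : ℂ) * q ^ n) 0 ?_
          using 1
        · simp [hQ]
        · intro n hn
          simp [hQ, PowerSeries.coeff_one, hn]
      exact ⟨this.summable.norm, by simpa using this⟩
    | succ N ih =>
      rw [hQs, Finset.prod_range_succ]
      exact pa_mul_hasSum ih.1 ih.2 (hns q hq N) (hsum N q hq)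
  have htend : ∀ (q : ℂ), ‖q‖ < 1 → Tendsto (fun N => ∏ i ∈ Finset.range N, (1 + u i q)) atTop
      (𝓝 (∏' i, (1 + u i q))) := fun q hq =>
    (multipliable_one_add_of_summable (hu q hq)).hasProd.tendsto_prod_nat
  -- summability of the dominating series
  have hdom : Summable fun n => PowerSeries.coeff n A * ‖q‖ ^ n := by
    have hq' : ‖((‖q‖ : ℝ) : ℂ)‖ < 1 := by simpa using hq
    obtain ⟨B, hB⟩ := (htend _ hq').norm.bddAbove_range
    refine summable_of_sum_range_le (c := B) (fun n => mul_nonneg (hA0 n) (by positivity)) fun M => ?_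
    have h1 : Tendsto (fun N => ∑ n ∈ Finset.range M, PowerSeries.coeff n (Q N) * ‖q‖ ^ n) atTop
        (𝓝 (∑ n ∈ Finset.range M, PowerSeries.coeff n A * ‖q‖ ^ n)) :=
      tendsto_finsetSum _ fun n _ => (hlim n).mul_const _
    refine le_of_tendsto' h1 fun N => ?_
    obtain ⟨h2, h3⟩ := hQsum _ hq' N
    have h4 : HasSum (fun n => PowerSeries.coeff n (Q N) * ‖q‖ ^ n)
        (∏ i ∈ Finset.range N, (1 + u i ((‖q‖ : ℝ) : ℂ))).re := by
      convert Complex.hasSum_re h3 using 2 with n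
      norm_cast
    refine (sum_le_hasSum _ (fun n _ => mul_nonneg (hQ0 N n) (by positivity)) h4).trans ?_
    exact (Complex.re_le_norm _).trans (hB ⟨N, rfl⟩)
  have hAs : Summable fun n => ((PowerSeries.coeff n A : ℝ) : ℂ) * q ^ n := by
    refine Summable.of_norm ?_
    simpa only [hr _ A q (hA0 _)] using hdom
  have hT := tendsto_tsum_of_dominated_convergence (𝓕 := atTop)
    (f := fun N n => ((PowerSeries.coeff n (Q N) : ℝ) : ℂ) * q ^ n)
    (g := fun n => ((PowerSeries.coeff n A : ℝ) : ℂ) * q ^ n) hdom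
    (fun n => ((Complex.continuous_ofReal.tendsto _).comp (hlim n)).mul_const _)
    (Eventually.of_forall fun N n => by
      rw [hr _ _ _ (hQ0 N n)]
      exact mul_le_mul_of_nonneg_right (hle N n) (by positivity))
  have : (fun N => ∑' n, ((PowerSeries.coeff n (Q N) : ℝ) : ℂ) * q ^ n) =
      fun N => ∏ i ∈ Finset.range N, (1 + u i q) := by
    funext N
    exact (hQsum q hq N).2.tsum_eq
  rw [this] at hT
  rw [← tendsto_nhds_unique hT (htend q hq)]
  exact hAs.hasSum

/-- the character -/
noncomputable def paF (_ j : ℕ) : ℝ := if Odd j then 1 else 0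

open scoped PowerSeries.WithPiTopology

noncomputable def paP (i : ℕ) : PowerSeries ℝ :=
  1 + ∑' j, paF (i + 1) (j + 1) • (PowerSeries.X : PowerSeries ℝ) ^ ((i + 1) * (j + 1))

theorem paP_coeff (i m : ℕ) : PowerSeries.coeff m (paP i) =
    (if m = 0 then 1 else 0) + if (i + 1) ∣ m ∧ Odd (m / (i + 1)) then 1 else 0 := by
  rw [paP, map_add, PowerSeries.coeff_one, (Nat.Partition.summable_genFun_term paF i).map_tsum _
    (PowerSeries.WithPiTopology.continuous_coeff _ _)]
  congr 1
  simp only [map_smul, PowerSeries.coeff_X_pow, smul_eq_mul, paF]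
  split_ifs with h
  · obtain ⟨⟨k, rfl⟩, h2⟩ := h
    rw [Nat.mul_div_cancel_left _ (Nat.succ_pos i)] at h2
    obtain ⟨l, rfl⟩ := h2
    rw [tsum_eq_single (2 * l)]
    · simp
    · intro b hb
      have : ¬ ((i + 1) * (2 * l + 1) = (i + 1) * (b + 1)) := by
        rw [Nat.mul_right_inj (by omega)]; omega
      simp [this]
  · convert tsum_zero with j
    by_cases hm : m = (i + 1) * (j + 1)
    · subst hm
      rw [Nat.mul_div_cancel_left _ (Nat.succ_pos i)] at h
      simp at h
      simp
      grind
    · simp [hm]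

theorem paP_hasSum (i : ℕ) (q : ℂ) (hq : ‖q‖ < 1) :
    HasSum (fun n => ((PowerSeries.coeff n (paP i) : ℝ) : ℂ) * q ^ n)
      (1 + q ^ (i + 1) / (1 - q ^ (2 * (i + 1)))) := by
  have hc : ∀ n : ℕ, ((PowerSeries.coeff n (paP i) : ℝ) : ℂ) * q ^ n =
      (if n = 0 then 1 else 0 : ℂ) * q ^ n +
      (if (i + 1) ∣ n ∧ Odd (n / (i + 1)) then 1 else 0 : ℂ) * q ^ n := by
    intro n
    rw [paP_coeff, ← add_mul]
    split_ifs <;> simp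
  simp_rw [hc]
  refine HasSum.add ?_ ?_
  · have := hasSum_single (f := fun n : ℕ => ((if n = 0 then 1 else 0 : ℂ)) * q ^ n) 0
      (fun n hn => by simp [hn])
    simpa only [if_true, pow_zero, mul_one] using this
  · have hinj : Function.Injective fun j : ℕ => (i + 1) * (2 * j + 1) := by
      intro a b h
      have := Nat.eq_of_mul_eq_mul_left (Nat.succ_pos i) h
      omega
    rw [← hinj.hasSum_iff]
    · have hg := (hasSum_geometric_of_norm_lt_one (ξ := q ^ (2 * (i + 1))) (by
        rw [norm_pow]; exact pow_lt_one₀ (norm_nonneg _) hq (by omega))).mul_left (q ^ (i + 1))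
      rw [← div_eq_mul_inv] at hg
      refine (congrArg (fun f => HasSum f (q ^ (i + 1) / (1 - q ^ (2 * (i + 1))))) ?_).mpr hg
      funext j
      simp only [Function.comp_apply]
      rw [if_pos, one_mul, ← pow_mul, ← pow_add]
      · congr 1; ring
      · rw [Nat.mul_div_cancel_left _ (Nat.succ_pos i)]
        exact ⟨Dvd.intro _ rfl, j, rfl⟩
    · intro x hx
      rw [if_neg, zero_mul]
      rintro ⟨⟨k, rfl⟩, h2⟩
      rw [Nat.mul_div_cancel_left _ (Nat.succ_pos i)] at h2
      obtain ⟨l, rfl⟩ := h2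
      exact hx ⟨l, rfl⟩

theorem pa_u_summable (q : ℂ) (hq : ‖q‖ < 1) :
    Summable fun i : ℕ => ‖q ^ (i + 1) / (1 - q ^ (2 * (i + 1)))‖ := by
  have h1 : Summable fun i : ℕ => ‖q‖ ^ i * (1 / (1 - ‖q‖)) :=
    (summable_geometric_of_lt_one (norm_nonneg _) hq).mul_right _
  refine Summable.of_nonneg_of_le (fun _ => norm_nonneg _) (fun i => ?_) h1
  rw [norm_div, norm_pow, div_eq_mul_one_div]
  have h2 : ‖q‖ ^ (2 * (i + 1)) ≤ ‖q‖ := pow_le_of_le_one (norm_nonneg _) hq.le (by omega)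
  have h3 : 1 - ‖q‖ ≤ ‖1 - q ^ (2 * (i + 1))‖ := by
    have := norm_sub_norm_le (1 : ℂ) (q ^ (2 * (i + 1)))
    rw [norm_one, norm_pow] at this
    linarith
  have h4 : 0 < 1 - ‖q‖ := by linarith
  gcongr ?_ * ?_
  · exact pow_le_pow_of_le_one (norm_nonneg _) hq.le (by omega)
  · exact one_div_le_one_div_of_le h4 h3

theorem pa_genFun (q : ℂ) (hq : ‖q‖ < 1) :
    HasSum (fun n => ((PowerSeries.coeff n (Nat.Partition.genFun paF) : ℝ) : ℂ) * q ^ n)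
      (∏' i : ℕ, (1 + q ^ (i + 1) / (1 - q ^ (2 * (i + 1))))) := by
  refine pa_analytic paP _ (fun i q => q ^ (i + 1) / (1 - q ^ (2 * (i + 1)))) ?_ ?_ ?_
    paP_hasSum pa_u_summable q hq
  · intro i n
    rw [paP_coeff]
    split_ifs <;> norm_num
  · intro i
    simp [paP_coeff]
  · intro n
    exact ((PowerSeries.WithPiTopology.continuous_coeff ℝ n).tendsto _).comp
      (Nat.Partition.hasProd_genFun paF).tendsto_prod_nat

theorem pa_coeff_genFun (n : ℕ) : PowerSeries.coeff n (Nat.Partition.genFun paF) =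
    (Nat.card {p : n.Partition // ∀ i ∈ p.parts, Odd (p.parts.count i)} : ℝ) := by
  classical
  rw [Nat.Partition.coeff_genFun, Nat.card_eq_fintype_card, Fintype.card_subtype,
    Finset.card_filter]
  push_cast
  refine Finset.sum_congr rfl fun p _ => ?_
  simp only [Finsupp.prod, Multiset.toFinsupp_support, Multiset.toFinsupp_apply]
  simp only [paF]
  rw [Finset.prod_ite_zero]
  simp

theorem paOdd_generating_function (q : ℂ) (hq : ‖q‖ < 1) :
    1 + ∑' n : ℕ, (paOdd (n + 1) : ℂ) * q ^ (n + 1) =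
      ∏' k : ℕ, (1 + q ^ (k + 1) - q ^ (2 * (k + 1))) / (1 - q ^ (2 * (k + 1))) := by
  have hterm : ∀ k : ℕ, (1 + q ^ (k + 1) - q ^ (2 * (k + 1))) / (1 - q ^ (2 * (k + 1))) =
      1 + q ^ (k + 1) / (1 - q ^ (2 * (k + 1))) := by
    intro k
    have h : (1 : ℂ) - q ^ (2 * (k + 1)) ≠ 0 := by
      intro h0
      have h1 : ‖q ^ (2 * (k + 1))‖ < 1 := by
        rw [norm_pow]
        exact pow_lt_one₀ (norm_nonneg _) hq (by omega)
      rw [← sub_eq_zero.1 h0, norm_one] at h1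
      exact lt_irrefl _ h1
    rw [one_add_div h]
    congr 1
    ring
  simp_rw [hterm]
  have hs := pa_genFun q hq
  rw [← hs.tsum_eq, hs.summable.tsum_eq_zero_add]
  congr 1
  · rw [pa_coeff_genFun, pow_zero, mul_one]
    have hcard : Nat.card {p : Nat.Partition 0 // ∀ i ∈ p.parts, Odd (p.parts.count i)} = 1 := by
      rw [Nat.card_eq_one_iff_unique]
      refine ⟨inferInstance, ⟨⟨default, ?_⟩⟩⟩
      intro i hi
      have h1 := Multiset.le_sum_of_mem hi
      have h2 := (default : Nat.Partition 0).parts_pos hi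
      rw [(default : Nat.Partition 0).parts_sum] at h1
      omega
    rw [hcard]
    simp
  · refine tsum_congr fun n => ?_
    rw [pa_coeff_genFun, PAConj.paOdd_eq (Nat.succ_pos n)]
    push_cast
    rfl
end
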